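/- Suppose δ is a Vopěnka cardinal. Then for every A ⊆ V_δ there is a cardinal κ < δ which is <δ-strongly compact and <δ-strong for A, but is not Woodin. -/

import Mathlib

/-!
A framework for formalizing large-cardinal notions from
"Woodin for strong compactness cardinals" over the Mathlib model `ZFSet`
of ZFC.  The ambient set-theoretic universe `V` is the type `ZFSet`;
classes are sets `Set ZFSet`; everything is relativised to a "universe
class" `W : Set ZFSet` (the ambient universe being `W = Set.univ`), so
that the same definitions can also be interpreted inside transitive set
models of ZFC (used to express the forcing/consistency results).
-/

namespace WSC

/-! ### First-order formulas in the language of set theory -/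

/-- First-order formulas in the language `{∈}`, with `n` free (de Bruijn) variables. -/
inductive Fml : ℕ → Type where
  | mem {n} : Fin n → Fin n → Fml n
  | eq  {n} : Fin n → Fin n → Fml n
  | not {n} : Fml n → Fml n
  | and {n} : Fml n → Fml n → Fml n
  | ex  {n} : Fml (n + 1) → Fml n

namespace Fml

/-- Realization of a formula over the class `C`, with all quantifiers relativised to `C`. -/
def Realize (C : Set ZFSet) : ∀ {n}, Fml n → (Fin n → ZFSet) → Prop
  | _, .mem i j, v => v i ∈ v j
  | _, .eq i j, v => v i = v j
  | _, .not φ, v => ¬ Realize C φ v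
  | _, .and φ ψ, v => Realize C φ v ∧ Realize C ψ v
  | _, .ex φ, v => ∃ x ∈ C, Realize C φ (Fin.snoc v x)

def or {n} (φ ψ : Fml n) : Fml n := .not (.and (.not φ) (.not ψ))
def imp {n} (φ ψ : Fml n) : Fml n := Fml.or (.not φ) ψ
def iff {n} (φ ψ : Fml n) : Fml n := .and (imp φ ψ) (imp ψ φ)
def all {n} (φ : Fml (n + 1)) : Fml n := .not (.ex (.not φ))

/-- Universal closure. -/
def alls : ∀ {n}, Fml n → Fml 0
  | 0, φ => φ
  | _ + 1, φ => alls (all φ)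

/-- Renaming of variables. -/
def rename : ∀ {n m}, (Fin n → Fin m) → Fml n → Fml m
  | _, _, f, .mem i j => .mem (f i) (f j)
  | _, _, f, .eq i j => .eq (f i) (f j)
  | _, _, f, .not φ => .not (rename f φ)
  | _, _, f, .and φ ψ => .and (rename f φ) (rename f ψ)
  | _, _, f, .ex φ => .ex (rename (Fin.snoc (fun i => (f i).castSucc) (Fin.last _)) φ)

end Fml

/-- A sentence `φ` holds in the class `C`. -/
def Sat (C : Set ZFSet) (φ : Fml 0) : Prop := Fml.Realize C φ (fun i => i.elim0)

/-! ### The ZFC axioms -/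

def extAx : Fml 0 :=
  Fml.all (Fml.all (Fml.imp (Fml.all (Fml.iff (.mem 2 0) (.mem 2 1))) (.eq 0 1)))

def pairAx : Fml 0 := Fml.all (Fml.all (Fml.ex (Fml.and (.mem 0 2) (.mem 1 2))))

def unionAx : Fml 0 :=
  Fml.all (Fml.ex (Fml.all (Fml.all
    (Fml.imp (Fml.and (.mem 2 3) (.mem 3 0)) (.mem 2 1)))))

def powerAx : Fml 0 :=
  Fml.all (Fml.ex (Fml.all
    (Fml.imp (Fml.all (Fml.imp (.mem 3 2) (.mem 3 0))) (.mem 2 1))))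

def infAx : Fml 0 :=
  Fml.ex (Fml.and
    (Fml.ex (Fml.and (.mem 1 0) (Fml.all (Fml.not (.mem 2 1)))))
    (Fml.all (Fml.imp (.mem 1 0)
      (Fml.ex (Fml.and (.mem 2 0)
        (Fml.all (Fml.iff (.mem 3 2) (Fml.or (.mem 3 1) (.eq 3 1)))))))))

def foundAx : Fml 0 :=
  Fml.all (Fml.imp (Fml.ex (.mem 1 0))
    (Fml.ex (Fml.and (.mem 1 0) (Fml.all (Fml.imp (.mem 2 1) (Fml.not (.mem 2 0)))))))

def choiceAx : Fml 0 :=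
  Fml.all (Fml.imp
    (Fml.and
      (Fml.all (Fml.imp (.mem 1 0) (Fml.ex (.mem 2 1))))
      (Fml.all (Fml.all (Fml.imp
        (Fml.and (.mem 1 0) (Fml.and (.mem 2 0) (Fml.ex (Fml.and (.mem 3 1) (.mem 3 2)))))
        (.eq 1 2)))))
    (Fml.ex (Fml.all (Fml.imp (.mem 2 0)
      (Fml.ex (Fml.and (Fml.and (.mem 3 2) (.mem 3 1))
        (Fml.all (Fml.imp (Fml.and (.mem 4 2) (.mem 4 1)) (.eq 4 3)))))))))

/-- An instance of the separation schema, for a formula `φ` with parameters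
`0, …, n-1` and distinguished variable `n`. -/
def sepAx (n : ℕ) (φ : Fml (n + 1)) : Fml 0 :=
  Fml.alls ((Fml.ex (Fml.all (Fml.iff
    (Fml.mem (⟨n + 2, by omega⟩ : Fin (n + 3)) ⟨n + 1, by omega⟩)
    (Fml.and (Fml.mem (⟨n + 2, by omega⟩ : Fin (n + 3)) ⟨n, by omega⟩)
      (Fml.rename (fun i => if h : (i : ℕ) < n then (⟨i, by omega⟩ : Fin (n + 3))
        else ⟨n + 2, by omega⟩) φ))))) : Fml (n + 1))

/-- An instance of the collection schema, for a formula `φ` with parameters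
`0, …, n-1` and distinguished variables `n` (input) and `n+1` (output). -/
def collAx (n : ℕ) (φ : Fml (n + 2)) : Fml 0 :=
  let φ' : Fml (n + 4) := Fml.rename (fun i => if h : (i : ℕ) < n then (⟨i, by omega⟩ : Fin (n + 4))
    else ⟨(i : ℕ) + 2, by have := i.isLt; omega⟩) φ
  Fml.alls ((Fml.ex (Fml.all
    (Fml.imp (Fml.mem (⟨n + 2, by omega⟩ : Fin (n + 3)) ⟨n, by omega⟩)
      (Fml.imp (Fml.ex φ')
        (Fml.ex (Fml.and (Fml.mem (⟨n + 3, by omega⟩ : Fin (n + 4)) ⟨n + 1, by omega⟩) φ')))))) : Fml (n + 1))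

/-- The ZFC axioms. -/
def ZFCax : Set (Fml 0) :=
  {extAx, pairAx, unionAx, powerAx, infAx, foundAx, choiceAx} ∪
    (⋃ n, Set.range (sepAx n)) ∪ (⋃ n, Set.range (collAx n))

/-- A transitive set model of ZFC. -/
def IsZFModel (m : ZFSet) : Prop := m.IsTransitive ∧ ∀ φ ∈ ZFCax, Sat m.toSet φ

/-- A countable transitive model of ZFC. -/
def IsCtm (m : ZFSet) : Prop := IsZFModel m ∧ m.toSet.Countable

/-! ### Basic set-theoretic notions -/

/-- `x` is a (von Neumann) ordinal: a transitive set of transitive sets. -/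
def IsOrd (x : ZFSet) : Prop := x.IsTransitive ∧ ∀ y ∈ x, ZFSet.IsTransitive y

/-- `x ≤ y` for ordinals. -/
def oLe (x y : ZFSet) : Prop := x ∈ y ∨ x = y

/-- `f` is a function with domain `d` (coded as a set of Kuratowski pairs). -/
def IsFuncOn (d f : ZFSet) : Prop :=
  (∀ p ∈ f, ∃ a b : ZFSet, a ∈ d ∧ p = a.pair b) ∧ ∀ a ∈ d, ∃! b : ZFSet, a.pair b ∈ f

/-- All values of the (partial) function `f` lie in `b`. -/
def MapsInto (f b : ZFSet) : Prop := ∀ x y : ZFSet, x.pair y ∈ f → y ∈ b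

/-- The function `f` is injective. -/
def InjFun (f : ZFSet) : Prop := ∀ x x' y : ZFSet, x.pair y ∈ f → x'.pair y ∈ f → x = x'

/-- `|a| ≤ |b|`, witnessed by an injection belonging to the universe class `W`. -/
def SetLeIn (W : Set ZFSet) (a b : ZFSet) : Prop :=
  ∃ f ∈ W, IsFuncOn a f ∧ MapsInto f b ∧ InjFun f

/-- `κ` is a cardinal (relative to the universe class `W`). -/
def IsCardIn (W : Set ZFSet) (κ : ZFSet) : Prop :=
  IsOrd κ ∧ ∀ α ∈ κ, ¬ SetLeIn W κ α

/-- `M` is a transitive class. -/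
def TransClass (M : Set ZFSet) : Prop := ∀ x ∈ M, ∀ y : ZFSet, y ∈ x → y ∈ M

/-- An elementary embedding `j : (W, ∈) → (M, ∈)` between two classes. -/
structure ElemEmb (W M : Set ZFSet) where
  toFun : ZFSet → ZFSet
  maps : ∀ x ∈ W, toFun x ∈ M
  elem : ∀ {n : ℕ} (φ : Fml n) (v : Fin n → ZFSet), (∀ i, v i ∈ W) →
    (Fml.Realize W φ v ↔ Fml.Realize M φ (fun i => toFun (v i)))

/-- `κ` is the critical point of `j`: the least ordinal moved. -/
def IsCrit {W M : Set ZFSet} (j : ElemEmb W M) (κ : ZFSet) : Prop :=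
  IsOrd κ ∧ j.toFun κ ≠ κ ∧ ∀ α ∈ κ, j.toFun α = α

/-! ### The rank hierarchy -/

/-- `x ∈ V_lam`. -/
def VMem (lam x : ZFSet) : Prop := x.rank < lam.rank

/-- `V_lam ⊆ M` (with `V_lam` computed in the universe class `W`). -/
def VInclIn (W M : Set ZFSet) (lam : ZFSet) : Prop := ∀ x ∈ W, VMem lam x → x ∈ M

/-- `A ⊆ V_δ`. -/
def SubV (A δ : ZFSet) : Prop := ∀ x ∈ A, VMem δ x

/-- `A ∩ V_lam = B ∩ V_lam`. -/
def AgreeBelowIn (W : Set ZFSet) (lam A B : ZFSet) : Prop :=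
  ∀ x ∈ W, VMem lam x → (x ∈ A ↔ x ∈ B)

/-- `A ∩ lam = B ∩ lam` (for sets of ordinals). -/
def AgreeMem (lam A B : ZFSet) : Prop := ∀ ξ ∈ lam, (ξ ∈ A ↔ ξ ∈ B)

/-! ### Covering properties -/

/-- `M ⊨ |s| < t`: in `M` there is an injection of `s` into some ordinal `β ∈ t`. -/
def CardLtIn (M : Set ZFSet) (s t : ZFSet) : Prop :=
  ∃ β f : ZFSet, β ∈ t ∧ f ∈ M ∧ IsFuncOn s f ∧ MapsInto f β ∧ InjFun f

/-- `j` satisfies the weak `lam`-covering property (with target class `M`):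
there is `s ∈ M` with `j '' lam ⊆ s` and `M ⊨ |s| < j κ`. -/
def WCovers (M : Set ZFSet) (j : ZFSet → ZFSet) (κ lam : ZFSet) : Prop :=
  ∃ s ∈ M, (∀ α ∈ lam, j α ∈ s) ∧ CardLtIn M s (j κ)

/-- `j` satisfies the (full) `lam`-covering property: every `X ∈ W` with
`X ⊆ M` and `|X| ≤ lam` is covered by some `s ∈ M` with `M ⊨ |s| < j κ`. -/
def CoversIn (W M : Set ZFSet) (j : ZFSet → ZFSet) (κ lam : ZFSet) : Prop :=
  ∀ X ∈ W, X.toSet ⊆ M → SetLeIn W X lam → ∃ s ∈ M, X ⊆ s ∧ CardLtIn M s (j κ)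

/-! ### Strongness -/

/-- `κ` is `lam`-strong. -/
def LamStrongIn (W : Set ZFSet) (κ lam : ZFSet) : Prop :=
  ∃ M : Set ZFSet, M ⊆ W ∧ TransClass M ∧ ∃ j : ElemEmb W M,
    IsCrit j κ ∧ lam ∈ j.toFun κ ∧ VInclIn W M lam

/-- `κ` is `lam`-strong for `A`. -/
def LamStrongForIn (W : Set ZFSet) (κ lam A : ZFSet) : Prop :=
  ∃ M : Set ZFSet, M ⊆ W ∧ TransClass M ∧ ∃ j : ElemEmb W M,
    IsCrit j κ ∧ lam ∈ j.toFun κ ∧ VInclIn W M lam ∧ AgreeBelowIn W lam A (j.toFun A)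

/-- `κ` is `<δ`-strong. -/
def LtStrongIn (W : Set ZFSet) (κ δ : ZFSet) : Prop :=
  ∀ lam : ZFSet, oLe κ lam → lam ∈ δ → LamStrongIn W κ lam

/-- `κ` is `<δ`-strong for `A`. -/
def LtStrongForIn (W : Set ZFSet) (κ δ A : ZFSet) : Prop :=
  ∀ lam : ZFSet, oLe κ lam → lam ∈ δ → LamStrongForIn W κ lam A

/-! ### Strong compactness -/

/-- `κ` is `lam`-strongly compact (there is an embedding with critical point `κ`,
`j κ > lam`, satisfying the weak `lam`-covering property). -/
def LamSCIn (W : Set ZFSet) (κ lam : ZFSet) : Prop :=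
  ∃ M : Set ZFSet, M ⊆ W ∧ TransClass M ∧ ∃ j : ElemEmb W M,
    IsCrit j κ ∧ lam ∈ j.toFun κ ∧ WCovers M j.toFun κ lam

/-- `κ` is `lam`-strongly compact for the set of ordinals `A`: there is a
`lam`-strong compactness embedding `j` (one with the full `lam`-covering
property) with critical point `κ` and `A ∩ lam = j A ∩ lam`. -/
def LamSCForIn (W : Set ZFSet) (κ lam A : ZFSet) : Prop :=
  ∃ M : Set ZFSet, M ⊆ W ∧ TransClass M ∧ ∃ j : ElemEmb W M,
    IsCrit j κ ∧ lam ∈ j.toFun κ ∧ CoversIn W M j.toFun κ lam ∧ AgreeMem lam A (j.toFun A)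

/-- `κ` is `<δ`-strongly compact. -/
def LtSCIn (W : Set ZFSet) (κ δ : ZFSet) : Prop :=
  ∀ lam : ZFSet, oLe κ lam → lam ∈ δ → LamSCIn W κ lam

/-- `κ` is `<δ`-strongly compact for `A`. -/
def LtSCForIn (W : Set ZFSet) (κ δ A : ZFSet) : Prop :=
  ∀ lam : ZFSet, oLe κ lam → lam ∈ δ → LamSCForIn W κ lam A

/-! ### Supercompactness -/

/-- `M` is closed under `lam`-sequences (from the universe class `W`). -/
def SeqClosedIn (W M : Set ZFSet) (lam : ZFSet) : Prop :=
  ∀ f ∈ W, IsFuncOn lam f → (∀ x y : ZFSet, x.pair y ∈ f → y ∈ M) → f ∈ M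

/-- `κ` is `lam`-supercompact. -/
def LamSupercompactIn (W : Set ZFSet) (κ lam : ZFSet) : Prop :=
  ∃ M : Set ZFSet, M ⊆ W ∧ TransClass M ∧ ∃ j : ElemEmb W M,
    IsCrit j κ ∧ lam ∈ j.toFun κ ∧ SeqClosedIn W M lam

/-- `κ` is `lam`-supercompact for `A`. -/
def LamSupercompactForIn (W : Set ZFSet) (κ lam A : ZFSet) : Prop :=
  ∃ M : Set ZFSet, M ⊆ W ∧ TransClass M ∧ ∃ j : ElemEmb W M,
    IsCrit j κ ∧ lam ∈ j.toFun κ ∧ SeqClosedIn W M lam ∧ AgreeBelowIn W lam A (j.toFun A)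

/-- `κ` is `<δ`-supercompact. -/
def LtSupercompactIn (W : Set ZFSet) (κ δ : ZFSet) : Prop :=
  ∀ lam : ZFSet, oLe κ lam → lam ∈ δ → LamSupercompactIn W κ lam

/-- `κ` is `<δ`-supercompact for `A`. -/
def LtSupercompactForIn (W : Set ZFSet) (κ δ A : ZFSet) : Prop :=
  ∀ lam : ZFSet, oLe κ lam → lam ∈ δ → LamSupercompactForIn W κ lam A

/-! ### The global large-cardinal notions -/

/-- `δ` is a Woodin cardinal. -/
def WoodinIn (W : Set ZFSet) (δ : ZFSet) : Prop :=
  IsCardIn W δ ∧ ∀ A ∈ W, SubV A δ → ∃ κ, κ ∈ δ ∧ LtStrongForIn W κ δ A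

/-- `δ` is a Woodin for strong compactness cardinal. -/
def WoodinSCIn (W : Set ZFSet) (δ : ZFSet) : Prop :=
  IsCardIn W δ ∧ ∀ A ∈ W, A ⊆ δ → ∃ κ, κ ∈ δ ∧ LtSCForIn W κ δ A

/-- `δ` is a Vopěnka cardinal. -/
def VopenkaIn (W : Set ZFSet) (δ : ZFSet) : Prop :=
  IsCardIn W δ ∧ ∀ A ∈ W, SubV A δ → ∃ κ, κ ∈ δ ∧ LtSupercompactForIn W κ δ A

/-- `δ` is Woodin and a limit of `<δ`-supercompact cardinals. -/
def WoodinLimSupercompactIn (W : Set ZFSet) (δ : ZFSet) : Prop :=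
  WoodinIn W δ ∧ ∀ α ∈ δ, ∃ κ : ZFSet, α ∈ κ ∧ κ ∈ δ ∧ LtSupercompactIn W κ δ

/-! ### Inaccessibility -/

/-- `δ` is a regular ordinal: the range of any function from a smaller
ordinal into `δ` is bounded. -/
def RegularIn (W : Set ZFSet) (δ : ZFSet) : Prop :=
  IsOrd δ ∧ ∀ α ∈ δ, ∀ f ∈ W, IsFuncOn α f → MapsInto f δ →
    ∃ β ∈ δ, ∀ x y : ZFSet, x.pair y ∈ f → y ∈ β

/-- The power set of `x` relative to `W`. -/
def powersetIn (W : Set ZFSet) (x : ZFSet) : ZFSet := ZFSet.sep (fun z => z ∈ W) x.powerset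

/-- `δ` is a strong limit cardinal. -/
def StrongLimitIn (W : Set ZFSet) (δ : ZFSet) : Prop :=
  IsCardIn W δ ∧ ∀ α ∈ δ, ∃ β ∈ δ, SetLeIn W (powersetIn W α) β

/-- `δ` is inaccessible: an uncountable regular strong limit cardinal. -/
def InaccessibleIn (W : Set ZFSet) (δ : ZFSet) : Prop :=
  ZFSet.omega ∈ δ ∧ IsCardIn W δ ∧ RegularIn W δ ∧ StrongLimitIn W δ

/-! ### Ultrafilters and measurability -/

/-- Relative complement `a \ b`. -/
def zdiff (a b : ZFSet) : ZFSet := ZFSet.sep (fun x => x ∉ b) a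

/-- Intersection `a ∩ b`. -/
def zinter (a b : ZFSet) : ZFSet := ZFSet.sep (fun x => x ∈ b) a

/-- `U` is a nonprincipal `α`-complete ultrafilter on `α`. -/
def IsUfOnIn (W : Set ZFSet) (α U : ZFSet) : Prop :=
  (∀ x ∈ U, x ⊆ α) ∧ α ∈ U ∧ (∅ : ZFSet) ∉ U ∧
  (∀ x ∈ U, ∀ y : ZFSet, y ∈ W → y ⊆ α → x ⊆ y → y ∈ U) ∧
  (∀ x ∈ W, x ⊆ α → (x ∈ U ∨ zdiff α x ∈ U)) ∧
  (∀ β ∈ α, ∀ g ∈ W, IsFuncOn β g → MapsInto g U →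
    ZFSet.sep (fun ξ => ∀ p q : ZFSet, p.pair q ∈ g → ξ ∈ q) α ∈ U) ∧
  (∀ ξ ∈ α, ZFSet.sep (fun x => x = ξ) α ∉ U)

/-- `U` is a normal ultrafilter on `α`: a nonprincipal `α`-complete
ultrafilter closed under diagonal intersections. -/
def IsNormalUfOnIn (W : Set ZFSet) (α U : ZFSet) : Prop :=
  IsUfOnIn W α U ∧
    ∀ g ∈ W, IsFuncOn α g → MapsInto g U →
      ZFSet.sep (fun ξ => ∀ p q : ZFSet, p.pair q ∈ g → p ∈ ξ → ξ ∈ q) α ∈ U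

/-- `α` is a measurable cardinal. -/
def MeasurableIn (W : Set ZFSet) (α : ZFSet) : Prop := ∃ U ∈ W, IsUfOnIn W α U

/-! ### Functions `f : δ → δ` and closure points -/

/-- `f` codes a function from `δ` to `δ`. -/
def FuncSelf (δ f : ZFSet) : Prop := IsFuncOn δ f ∧ MapsInto f δ

/-- `κ` is a closure point of `f`, i.e. `f '' κ ⊆ κ`. -/
def ClosurePt (f κ : ZFSet) : Prop := ∀ x y : ZFSet, x.pair y ∈ f → x ∈ κ → y ∈ κ

/-! ### GCH -/

/-- GCH: for every infinite cardinal `κ`, any family of subsets of `κ` has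
size at most `κ` or size at least that of the full power set of `κ`. -/
def GCHIn (W : Set ZFSet) : Prop :=
  ∀ κ ∈ W, IsCardIn W κ → oLe ZFSet.omega κ →
    ∀ X ∈ W, (∀ z ∈ X, z ⊆ κ) → (SetLeIn W X κ ∨ SetLeIn W (powersetIn W κ) X)

/-! ### Forcing -/

/-- `(P, R)` is a forcing notion (a preordered set, `x.pair y ∈ R` meaning
`x ≤ y`, i.e. `x` is stronger than `y`). -/
def IsPoset (P R : ZFSet) : Prop :=
  (∀ p ∈ P, p.pair p ∈ R) ∧
  (∀ p q r : ZFSet, p.pair q ∈ R → q.pair r ∈ R → p.pair r ∈ R) ∧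
  (∀ x y : ZFSet, x.pair y ∈ R → x ∈ P ∧ y ∈ P)

/-- `G` is an `m`-generic filter on the forcing notion `(P, R) ∈ m`. -/
def IsGenericFilter (m P R G : ZFSet) : Prop :=
  G ⊆ P ∧
  (∀ p ∈ G, ∀ q ∈ P, p.pair q ∈ R → q ∈ G) ∧
  (∀ p ∈ G, ∀ q ∈ G, ∃ r ∈ G, r.pair p ∈ R ∧ r.pair q ∈ R) ∧
  (∀ D ∈ m, (D ⊆ P ∧ ∀ p ∈ P, ∃ q ∈ D, q.pair p ∈ R) → ∃ q, q ∈ G ∧ q ∈ D)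

/-- `n = m[G]` : `n` is a transitive ZFC-model extending `m` and containing
`G`, and is the least such. -/
def IsGenericExt (m G n : ZFSet) : Prop :=
  IsZFModel n ∧ m ⊆ n ∧ G ∈ n ∧
    ∀ n' : ZFSet, IsZFModel n' → m ⊆ n' → G ∈ n' → n ⊆ n'

/-- `n` is a (set-)forcing extension of the transitive model `m`. -/
def IsForcingExt (m n : ZFSet) : Prop :=
  ∃ P R G : ZFSet, P ∈ m ∧ R ∈ m ∧ IsPoset P R ∧
    IsGenericFilter m P R G ∧ IsGenericExt m G n

/-! ### Ambient (full-universe) abbreviations -/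

abbrev LamStrong (κ lam : ZFSet) : Prop := LamStrongIn Set.univ κ lam
abbrev LamStrongFor (κ lam A : ZFSet) : Prop := LamStrongForIn Set.univ κ lam A
abbrev LtStrong (κ δ : ZFSet) : Prop := LtStrongIn Set.univ κ δ
abbrev LtStrongFor (κ δ A : ZFSet) : Prop := LtStrongForIn Set.univ κ δ A
abbrev LamSC (κ lam : ZFSet) : Prop := LamSCIn Set.univ κ lam
abbrev LamSCFor (κ lam A : ZFSet) : Prop := LamSCForIn Set.univ κ lam A
abbrev LtSC (κ δ : ZFSet) : Prop := LtSCIn Set.univ κ δ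
abbrev LtSCFor (κ δ A : ZFSet) : Prop := LtSCForIn Set.univ κ δ A
abbrev LamSupercompact (κ lam : ZFSet) : Prop := LamSupercompactIn Set.univ κ lam
abbrev LtSupercompact (κ δ : ZFSet) : Prop := LtSupercompactIn Set.univ κ δ
abbrev Woodin (δ : ZFSet) : Prop := WoodinIn Set.univ δ
abbrev WoodinSC (δ : ZFSet) : Prop := WoodinSCIn Set.univ δ
abbrev Vopenka (δ : ZFSet) : Prop := VopenkaIn Set.univ δ
abbrev IsCard (κ : ZFSet) : Prop := IsCardIn Set.univ κ
abbrev Inaccessible (δ : ZFSet) : Prop := InaccessibleIn Set.univ δ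
abbrev Covers (M : Set ZFSet) (j : ZFSet → ZFSet) (κ lam : ZFSet) : Prop :=
  CoversIn Set.univ M j κ lam
abbrev VIncl (M : Set ZFSet) (lam : ZFSet) : Prop := VInclIn Set.univ M lam
abbrev AgreeBelow (lam A B : ZFSet) : Prop := AgreeBelowIn Set.univ lam A B
abbrev SeqClosed (M : Set ZFSet) (lam : ZFSet) : Prop := SeqClosedIn Set.univ M lam


section Proof
universe u

section Part1

/-! ### Definability machinery -/

/-- A class-indexed predicate that is uniformly definable over transitive classes. -/
def Df {n : ℕ} (P : Set ZFSet → (Fin n → ZFSet) → Prop) : Prop :=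
  ∃ φ : Fml n, ∀ C, TransClass C → ∀ v, (∀ i, v i ∈ C) → (Fml.Realize C φ v ↔ P C v)

namespace Df

variable {n m : ℕ}

theorem congr {P Q : Set ZFSet → (Fin n → ZFSet) → Prop} (h : Df P)
    (e : ∀ C, TransClass C → ∀ v, (∀ i, v i ∈ C) → (P C v ↔ Q C v)) : Df Q := by
  obtain ⟨φ, hφ⟩ := h
  exact ⟨φ, fun C hC v hv => (hφ C hC v hv).trans (e C hC v hv)⟩

theorem mem (i j : Fin n) : Df (fun _ v => v i ∈ v j) := ⟨.mem i j, fun _ _ _ _ => Iff.rfl⟩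

theorem eq (i j : Fin n) : Df (fun _ v => v i = v j) := ⟨.eq i j, fun _ _ _ _ => Iff.rfl⟩

theorem not {P : Set ZFSet → (Fin n → ZFSet) → Prop} (h : Df P) : Df (fun C v => ¬ P C v) := by
  obtain ⟨φ, hφ⟩ := h
  exact ⟨.not φ, fun C hC v hv => not_congr (hφ C hC v hv)⟩

theorem and {P Q : Set ZFSet → (Fin n → ZFSet) → Prop} (h : Df P) (h' : Df Q) :
    Df (fun C v => P C v ∧ Q C v) := by
  obtain ⟨φ, hφ⟩ := h
  obtain ⟨ψ, hψ⟩ := h'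
  exact ⟨.and φ ψ, fun C hC v hv => and_congr (hφ C hC v hv) (hψ C hC v hv)⟩

theorem or {P Q : Set ZFSet → (Fin n → ZFSet) → Prop} (h : Df P) (h' : Df Q) :
    Df (fun C v => P C v ∨ Q C v) :=
  (h.not.and h'.not).not.congr (fun _ _ _ _ => by tauto)

theorem imp {P Q : Set ZFSet → (Fin n → ZFSet) → Prop} (h : Df P) (h' : Df Q) :
    Df (fun C v => P C v → Q C v) :=
  (h.and h'.not).not.congr (fun _ _ _ _ => by tauto)

theorem iff {P Q : Set ZFSet → (Fin n → ZFSet) → Prop} (h : Df P) (h' : Df Q) :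
    Df (fun C v => P C v ↔ Q C v) :=
  ((h.imp h').and (h'.imp h)).congr (fun _ _ _ _ => by tauto)

theorem ex {P : Set ZFSet → (Fin n → ZFSet) → ZFSet → Prop}
    (h : Df (fun C (w : Fin (n + 1) → ZFSet) => P C (fun i => w i.castSucc) (w (Fin.last n)))) :
    Df (fun C v => ∃ x ∈ C, P C v x) := by
  obtain ⟨φ, hφ⟩ := h
  refine ⟨.ex φ, fun C hC v hv => ?_⟩
  simp only [Fml.Realize]
  refine exists_congr fun x => and_congr_right fun hx => ?_
  rw [hφ C hC]
  · simp
  · intro i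
    refine Fin.lastCases ?_ (fun i => ?_) i
    · simpa using hx
    · simpa using hv i

theorem all {P : Set ZFSet → (Fin n → ZFSet) → ZFSet → Prop}
    (h : Df (fun C (w : Fin (n + 1) → ZFSet) => P C (fun i => w i.castSucc) (w (Fin.last n)))) :
    Df (fun C v => ∀ x ∈ C, P C v x) :=
  (Df.ex (P := fun C v x => ¬ P C v x) h.not).not.congr (fun C _ v _ => by push Not; rfl)

theorem bex {P : Set ZFSet → (Fin n → ZFSet) → ZFSet → Prop} (k : Fin n)
    (h : Df (fun C (w : Fin (n + 1) → ZFSet) => P C (fun i => w i.castSucc) (w (Fin.last n)))) :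
    Df (fun C v => ∃ x ∈ v k, P C v x) :=
  (Df.ex (P := fun C v x => x ∈ v k ∧ P C v x) ((Df.mem _ _).and h)).congr
    (fun C hC v hv => ⟨fun ⟨x, _, h⟩ => ⟨x, h⟩, fun ⟨x, h⟩ => ⟨x, hC _ (hv k) _ h.1, h⟩⟩)

theorem ball {P : Set ZFSet → (Fin n → ZFSet) → ZFSet → Prop} (k : Fin n)
    (h : Df (fun C (w : Fin (n + 1) → ZFSet) => P C (fun i => w i.castSucc) (w (Fin.last n)))) :
    Df (fun C v => ∀ x ∈ v k, P C v x) :=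
  (Df.bex (P := fun C v x => ¬ P C v x) k h.not).not.congr (fun C _ v _ => by push Not; rfl)

theorem tru : Df (fun _ (_ : Fin n → ZFSet) => True) :=
  (Df.all (P := fun _ _ x => x = x) (Df.eq _ _)).congr (fun _ _ _ _ => by simp)

theorem forallFin : ∀ {k : ℕ} {P : Fin k → Set ZFSet → (Fin n → ZFSet) → Prop},
    (∀ i, Df (P i)) → Df (fun C v => ∀ i, P i C v)
  | 0, _, _ => tru.congr (fun _ _ _ _ => by simp)
  | k + 1, P, h => ((forallFin (P := fun i => P i.castSucc) (fun i => h _)).and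
      (h (Fin.last k))).congr (fun _ _ _ _ => by rw [Fin.forall_fin_succ']; )

theorem allN : ∀ {k : ℕ} {P : Set ZFSet → (Fin n → ZFSet) → (Fin k → ZFSet) → Prop},
    Df (fun C (w : Fin (n + k) → ZFSet) =>
      P C (fun i => w (Fin.castAdd k i)) (fun i => w (Fin.natAdd n i))) →
    Df (fun C v => ∀ y : Fin k → ZFSet, (∀ i, y i ∈ C) → P C v y)
  | 0, P, h => by
    refine Df.congr h fun C _ v _ => ?_
    constructor
    · intro h y _
      have e : y = fun i : Fin 0 => v (Fin.natAdd (m := 0) n i) := funext fun i => i.elim0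
      rw [e]
      exact h
    · intro h
      exact h _ (fun i => i.elim0)
  | k + 1, P, h => by
    refine Df.congr (Df.allN (k := k) (P := fun C v y => ∀ x ∈ C, P C v (Fin.snoc y x)) ?_) ?_
    · refine Df.all (P := fun C w x => P C (fun i => w (Fin.castAdd k i))
        (Fin.snoc (fun i => w (Fin.natAdd n i)) x)) ?_
      refine Df.congr h fun C _ w _ => ?_
      have e : (Fin.snoc (fun i => w (Fin.natAdd n i).castSucc) (w (Fin.last (n + k))) :
          Fin (k + 1) → ZFSet) = fun i => w (Fin.natAdd n i) := by
        funext i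
        refine Fin.lastCases ?_ (fun i => ?_) i
        · simp
        · simp
      rw [e]
      rfl
    · intro C _ v _
      constructor
      · intro h y hy
        have := h (fun i => y i.castSucc) (fun i => hy _) (y (Fin.last k)) (hy _)
        have e : (Fin.snoc (fun i => y i.castSucc) (y (Fin.last k)) : Fin (k + 1) → ZFSet) = y :=
          Fin.snoc_init_self y
        rwa [e] at this
      · intro h y hy x hx
        refine h _ (fun i => ?_)
        refine Fin.lastCases ?_ (fun i => ?_) i
        · simpa using hx
        · simpa using hy i

end Df

theorem Fml.realize_rename (C : Set ZFSet) : ∀ {n m : ℕ} (f : Fin n → Fin m) (φ : Fml n)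
    (v : Fin m → ZFSet), Fml.Realize C (φ.rename f) v ↔ Fml.Realize C φ (fun i => v (f i))
  | _, _, f, .mem i j, v => Iff.rfl
  | _, _, f, .eq i j, v => Iff.rfl
  | _, _, f, .not φ, v => not_congr (realize_rename C f φ v)
  | _, _, f, .and φ ψ, v => and_congr (realize_rename C f φ v) (realize_rename C f ψ v)
  | n, m, f, .ex φ, v => by
    simp only [Fml.rename, Fml.Realize]
    refine exists_congr fun x => and_congr_right fun _ => ?_
    rw [realize_rename C _ φ]
    have : (fun i => (Fin.snoc v x : Fin (m + 1) → ZFSet)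
        ((Fin.snoc (fun i => (f i).castSucc) (Fin.last m) : Fin (n + 1) → Fin (m + 1)) i)) =
        (Fin.snoc (fun i => v (f i)) x : Fin (n + 1) → ZFSet) := by
      funext i
      refine Fin.lastCases ?_ (fun i => ?_) i
      · simp
      · simp
    rw [this]

namespace Df

variable {n m : ℕ}

theorem rename {P : Set ZFSet → (Fin n → ZFSet) → Prop} (h : Df P) (f : Fin n → Fin m) :
    Df (fun C v => P C (fun i => v (f i))) := by
  obtain ⟨φ, hφ⟩ := h
  exact ⟨φ.rename f, fun C hC v hv => (Fml.realize_rename C f φ v).trans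
    (hφ C hC _ (fun i => hv _))⟩

/-- Satisfaction in a set is definable. -/
theorem sat : ∀ {n m : ℕ} (φ : Fml n) (s : Fin m) (g : Fin n → Fin m),
    Df (fun _ v => Fml.Realize {y | y ∈ v s} φ (fun i => v (g i)))
  | _, _, .mem i j, s, g => Df.mem _ _
  | _, _, .eq i j, s, g => Df.eq _ _
  | _, _, .not φ, s, g => (sat φ s g).not
  | _, _, .and φ ψ, s, g => (sat φ s g).and (sat ψ s g)
  | n, m, .ex φ, s, g => by
    simp only [Fml.Realize]
    refine Df.bex (P := fun _ v x => Fml.Realize {y | y ∈ v s} φ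
      (Fin.snoc (fun i => v (g i)) x)) s ?_
    refine (sat φ s.castSucc (Fin.snoc (fun i => (g i).castSucc) (Fin.last m))).congr ?_
    intro C _ w _
    have : (fun i => w
        ((Fin.snoc (fun i => (g i).castSucc) (Fin.last m) : Fin (n + 1) → Fin (m + 1)) i)) =
        (Fin.snoc (fun i => w (g i).castSucc) (w (Fin.last m)) : Fin (n + 1) → ZFSet) := by
      funext i
      refine Fin.lastCases ?_ (fun i => ?_) i
      · simp
      · simp
    rw [this]

theorem sub (a b : Fin n) : Df (fun _ v => v a ⊆ v b) :=
  (Df.ball a (P := fun _ v x => x ∈ v b) (Df.mem _ _)).congr (fun _ _ _ _ => by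
    rw [ZFSet.subset_def])

theorem isSing (a b : Fin n) : Df (fun _ v => v a = {v b}) :=
  ((Df.mem b a).and (Df.ball a (P := fun _ v x => x = v b) (Df.eq _ _))).congr (fun _ _ v _ => by
    constructor
    · rintro ⟨h1, h2⟩
      ext z
      rw [ZFSet.mem_singleton]
      exact ⟨h2 z, fun h => h ▸ h1⟩
    · intro h
      rw [h]
      simp)

theorem isUpair (a b c : Fin n) : Df (fun _ v => v a = {v b, v c}) :=
  ((Df.mem b a).and ((Df.mem c a).and
    (Df.ball a (P := fun _ v x => x = v b ∨ x = v c) ((Df.eq _ _).or (Df.eq _ _))))).congr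
    (fun _ _ v _ => by
    constructor
    · rintro ⟨h1, h2, h3⟩
      ext z
      rw [ZFSet.mem_pair]
      exact ⟨h3 z, fun h => h.elim (fun h => h ▸ h1) (fun h => h ▸ h2)⟩
    · intro h
      rw [h]
      simp)

theorem isPair (a b c : Fin n) : Df (fun _ v => v a = (v b).pair (v c)) :=
  (Df.bex a (P := fun _ v s => ∃ t ∈ v a, s = {v b} ∧ t = {v b, v c} ∧ v a = {s, t})
    (Df.bex _ (P := fun _ w t => w (Fin.last _) = {w b.castSucc} ∧
      t = {w b.castSucc, w c.castSucc} ∧ w a.castSucc = {w (Fin.last _), t})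
      ((isSing _ _).and ((isUpair _ _ _).and (isUpair _ _ _))))).congr (fun _ _ v _ => by
    constructor
    · rintro ⟨s, _, t, _, rfl, rfl, h⟩
      exact h
    · intro h
      refine ⟨{v b}, ?_, {v b, v c}, ?_, rfl, rfl, h⟩
      · rw [h]; simp [ZFSet.pair]
      · rw [h]; simp [ZFSet.pair])

theorem pairMem (a b c : Fin n) : Df (fun _ v => (v b).pair (v c) ∈ v a) :=
  (Df.bex a (P := fun _ v p => p = (v b).pair (v c)) (isPair _ _ _)).congr (fun _ _ v _ => by simp)

end Df

theorem TransClass.of_pair {C : Set ZFSet} (hC : TransClass C) {x y f : ZFSet} (hf : f ∈ C)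
    (h : x.pair y ∈ f) : x ∈ C ∧ y ∈ C := by
  have h1 : ({x, y} : ZFSet) ∈ C := hC _ (hC _ hf _ h) _ (by simp [ZFSet.pair])
  exact ⟨hC _ h1 _ (by simp), hC _ h1 _ (by simp)⟩

namespace Df

variable {n m : ℕ}

theorem allPair {P : Set ZFSet → (Fin n → ZFSet) → ZFSet → ZFSet → Prop} (k : Fin n)
    (h : Df (fun C (w : Fin (n + 2) → ZFSet) => P C (fun i => w i.castSucc.castSucc)
      (w (Fin.last n).castSucc) (w (Fin.last (n + 1))))) :
    Df (fun C v => ∀ x y : ZFSet, x.pair y ∈ v k → P C v x y) :=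
  (Df.all (P := fun C v x => ∀ y ∈ C, x.pair y ∈ v k → P C v x y)
    (Df.all (P := fun C w y => (w (Fin.last n)).pair y ∈ w k.castSucc →
      P C (fun i => w i.castSucc) (w (Fin.last n)) y) ((pairMem _ _ _).imp h))).congr
    (fun C hC v hv => ⟨fun h x y hp => h x (hC.of_pair (hv k) hp).1 y (hC.of_pair (hv k) hp).2 hp,
      fun h x _ y _ hp => h x y hp⟩)

theorem exVal {P : Set ZFSet → (Fin n → ZFSet) → ZFSet → Prop} (k l : Fin n)
    (h : Df (fun C (w : Fin (n + 1) → ZFSet) => P C (fun i => w i.castSucc)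
      (w (Fin.last n)))) :
    Df (fun C v => ∃ y : ZFSet, (v l).pair y ∈ v k ∧ P C v y) :=
  (Df.ex (P := fun C v y => (v l).pair y ∈ v k ∧ P C v y) ((pairMem _ _ _).and h)).congr
    (fun C hC v hv => ⟨fun ⟨y, _, h⟩ => ⟨y, h⟩, fun ⟨y, h⟩ => ⟨y, (hC.of_pair (hv k) h.1).2, h⟩⟩)

theorem isFuncOn (d f : Fin n) : Df (fun _ v => IsFuncOn (v d) (v f)) := by
  have h1 : Df (fun _ v => ∀ p ∈ v f, ∃ a ∈ v d, ∃ s ∈ p, ∃ b ∈ s, p = a.pair b) :=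
    Df.ball _ (P := fun _ v p => ∃ a ∈ v d, ∃ s ∈ p, ∃ b ∈ s, p = a.pair b)
      (Df.bex _ (P := fun _ v a => ∃ s ∈ v (Fin.last _), ∃ b ∈ s, v (Fin.last _) = a.pair b)
        (Df.bex _ (P := fun _ v s => ∃ b ∈ s, v (Fin.last _).castSucc = (v (Fin.last _)).pair b)
          (Df.bex _ (P := fun _ v b => v (Fin.last _).castSucc.castSucc =
            (v (Fin.last _).castSucc).pair b) (isPair _ _ _))))
  have h2 : Df (fun _ v => ∀ a ∈ v d, ∃ b, a.pair b ∈ v f ∧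
      ∀ x y : ZFSet, x.pair y ∈ v f → x = a → y = b) :=
    Df.ball _ (P := fun _ v a => ∃ b, a.pair b ∈ v f ∧
      ∀ x y : ZFSet, x.pair y ∈ v f → x = a → y = b)
      (Df.exVal _ _ (P := fun _ v b => ∀ x y : ZFSet, x.pair y ∈ v f.castSucc →
        x = v (Fin.last _) → y = b) (Df.allPair _ (P := fun _ v x y => x = v (Fin.last _).castSucc →
          y = v (Fin.last _)) ((Df.eq _ _).imp (Df.eq _ _))))
  refine (h1.and h2).congr fun C hC v hv => ?_
  unfold IsFuncOn
  refine and_congr ?_ ?_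
  · refine forall₂_congr fun p hp => ?_
    constructor
    · rintro ⟨a, ha, s, _, b, _, h⟩
      exact ⟨a, b, ha, h⟩
    · rintro ⟨a, b, ha, h⟩
      refine ⟨a, ha, {a, b}, ?_, b, ?_, h⟩
      · rw [h]; simp [ZFSet.pair]
      · simp
  · refine forall₂_congr fun a ha => ?_
    refine exists_congr fun b => and_congr_right fun _ => ?_
    constructor
    · intro h y hy
      exact h a y hy rfl
    · rintro h x y hx rfl
      exact h y hx

theorem mapsInto (f b : Fin n) : Df (fun _ v => MapsInto (v f) (v b)) :=
  Df.allPair f (P := fun _ v _ y => y ∈ v b) (Df.mem _ _)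

theorem injFun (f : Fin n) : Df (fun _ v => InjFun (v f)) := by
  refine (Df.allPair f (P := fun _ v x y => ∀ x' y' : ZFSet, x'.pair y' ∈ v f → y' = y → x = x')
    (Df.allPair _ (P := fun _ w x' y' => y' = w (Fin.last _) → w (Fin.last _).castSucc = x')
      ((Df.eq _ _).imp (Df.eq _ _)))).congr fun C hC v hv => ?_
  constructor
  · intro h x x' y h1 h2
    exact h x y h1 x' y h2 rfl
  · rintro h x y h1 x' y' h2 rfl
    exact h x x' _ h1 h2

theorem isTrans (a : Fin n) : Df (fun _ v => ZFSet.IsTransitive (v a)) :=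
  Df.ball a (P := fun _ v y => y ⊆ v a) (sub _ _)

theorem isOrd (a : Fin n) : Df (fun _ v => IsOrd (v a)) :=
  (isTrans a).and (Df.ball a (P := fun _ _ y => ZFSet.IsTransitive y) (isTrans _))

end Df


end Part1

section Part2

/-! ### Basic facts on elementary embeddings of the universe -/

theorem transClass_univ : TransClass Set.univ := fun _ _ _ _ => trivial

/-- The image of a set under an arbitrary function. -/
noncomputable def img (I : ZFSet.{u}) (f : ZFSet.{u} → ZFSet.{u}) : ZFSet.{u} :=
  ZFSet.range (fun a : Shrink.{u} I => f ((equivShrink.{u} I).symm a).1)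

theorem mem_img {I : ZFSet.{u}} {f : ZFSet.{u} → ZFSet.{u}} {y : ZFSet.{u}} :
    y ∈ img I f ↔ ∃ a ∈ I, f a = y := by
  unfold img
  rw [ZFSet.mem_range]
  constructor
  · rintro ⟨a, rfl⟩
    exact ⟨_, ((equivShrink.{u} I).symm a).2, rfl⟩
  · rintro ⟨a, ha, rfl⟩
    exact ⟨equivShrink.{u} I ⟨a, ha⟩, by simp⟩

/-- The graph of a function on a set. -/
noncomputable def gr (I : ZFSet.{u}) (f : ZFSet.{u} → ZFSet.{u}) : ZFSet.{u} := img I (fun a => a.pair (f a))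

theorem mem_gr {I : ZFSet.{u}} {f : ZFSet.{u} → ZFSet.{u}} {x y : ZFSet.{u}} :
    x.pair y ∈ gr I f ↔ x ∈ I ∧ f x = y := by
  unfold gr
  rw [mem_img]
  constructor
  · rintro ⟨a, ha, h⟩
    rw [ZFSet.pair_inj] at h
    obtain ⟨rfl, rfl⟩ := h
    exact ⟨ha, rfl⟩
  · rintro ⟨h, rfl⟩
    exact ⟨x, h, rfl⟩

theorem isFuncOn_gr (I : ZFSet.{u}) (f : ZFSet.{u} → ZFSet.{u}) : IsFuncOn I (gr I f) := by
  constructor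
  · intro p hp
    unfold gr at hp
    rw [mem_img] at hp
    obtain ⟨a, ha, rfl⟩ := hp
    exact ⟨a, f a, ha, rfl⟩
  · intro a ha
    exact ⟨f a, mem_gr.2 ⟨ha, rfl⟩, fun y hy => (mem_gr.1 hy).2.symm⟩

/-- Simulations: they witness comparisons of ranks. -/
def SimR (r : ZFSet) : Prop :=
  ∀ a b : ZFSet, a.pair b ∈ r → ∀ a' ∈ a, ∃ b' ∈ b, a'.pair b' ∈ r

theorem rank_le_of_sim {r : ZFSet} (hr : SimR r) (x : ZFSet) :
    ∀ y, x.pair y ∈ r → x.rank ≤ y.rank := by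
  induction x using ZFSet.inductionOn with
  | _ x ih =>
    intro y hy
    rw [ZFSet.rank_le_iff]
    intro a ha
    obtain ⟨b, hb, hab⟩ := hr x y hy a ha
    exact (ih a ha b hab).trans_lt (ZFSet.rank_lt_of_mem hb)

theorem exists_sim {x y : ZFSet} (h : x.rank ≤ y.rank) : ∃ r, x.pair y ∈ r ∧ SimR r := by
  set U := ZFSet.vonNeumann (y.rank + 1) with hU
  have hx : x ∈ U := by rw [hU, ZFSet.mem_vonNeumann]; exact Order.lt_succ_of_le h
  have hy : y ∈ U := by rw [hU, ZFSet.mem_vonNeumann]; exact Order.lt_succ_of_le le_rfl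
  have hT : U.IsTransitive := ZFSet.isTransitive_vonNeumann _
  have key : ∀ a b : ZFSet, a.pair b ∈ ZFSet.sep
      (fun p => ∃ a b : ZFSet, p = a.pair b ∧ a.rank ≤ b.rank) (U.prod U) ↔
      (a ∈ U ∧ b ∈ U) ∧ a.rank ≤ b.rank := by
    intro a b
    rw [ZFSet.mem_sep, ZFSet.pair_mem_prod]
    refine and_congr_right fun _ => ⟨?_, fun h => ⟨a, b, rfl, h⟩⟩
    rintro ⟨a', b', h, h'⟩
    rw [ZFSet.pair_inj] at h
    rw [h.1, h.2]
    exact h'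
  refine ⟨_, (key x y).2 ⟨⟨hx, hy⟩, h⟩, ?_⟩
  intro a b hab a' ha'
  rw [key] at hab
  obtain ⟨b', hb', hle⟩ := ZFSet.lt_rank_iff.1 ((ZFSet.rank_lt_of_mem ha').trans_le hab.2)
  exact ⟨b', hb', (key _ _).2 ⟨⟨hT _ hab.1.1 ha', hT _ hab.1.2 hb'⟩, hle⟩⟩

theorem Df.simR {n : ℕ} (r : Fin n) : Df (fun _ v => SimR (v r)) :=
  Df.allPair r (P := fun _ v a b => ∀ a' ∈ a, ∃ b' ∈ b, a'.pair b' ∈ v r)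
    (Df.ball _ (P := fun _ w a' => ∃ b' ∈ w (Fin.last _), a'.pair b' ∈ w r.castSucc.castSucc)
      (Df.bex _ (P := fun _ w b' => (w (Fin.last _)).pair b' ∈ w r.castSucc.castSucc.castSucc)
        (Df.pairMem _ _ _)))

/-- `V_θ` for the rank of `θ`. -/
noncomputable def VV (t : ZFSet) : ZFSet := ZFSet.vonNeumann t.rank

theorem mem_VV {x t : ZFSet} : x ∈ VV t ↔ x.rank < t.rank := ZFSet.mem_vonNeumann

theorem VV_trans (t : ZFSet) : (VV t).IsTransitive := ZFSet.isTransitive_vonNeumann _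

namespace ElemEmb

variable {M : Set ZFSet.{u}} (j : ElemEmb (Set.univ : Set ZFSet.{u}) M) (hM : TransClass M)

include hM

theorem tr {n : ℕ} {P : Set ZFSet → (Fin n → ZFSet) → Prop} (h : Df P) (v : Fin n → ZFSet) :
    P Set.univ v ↔ P M (fun i => j.toFun (v i)) := by
  obtain ⟨φ, hφ⟩ := h
  rw [← hφ _ transClass_univ v (fun _ => trivial), j.elem φ v (fun _ => trivial),
    hφ _ hM _ (fun i => j.maps _ trivial)]

theorem mem_iff (x y : ZFSet) : j.toFun x ∈ j.toFun y ↔ x ∈ y :=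
  (j.tr hM (Df.mem 0 1) ![x, y]).symm

theorem eq_iff (x y : ZFSet) : j.toFun x = j.toFun y ↔ x = y :=
  (j.tr hM (Df.eq 0 1) ![x, y]).symm

theorem sub (x y : ZFSet) (h : x ⊆ y) : j.toFun x ⊆ j.toFun y :=
  (j.tr hM (Df.sub 0 1) ![x, y]).1 h

theorem pair (x y : ZFSet) : j.toFun (x.pair y) = (j.toFun x).pair (j.toFun y) :=
  (j.tr hM (Df.isPair 0 1 2) ![x.pair y, x, y]).1 rfl

theorem sing (x : ZFSet) : j.toFun {x} = {j.toFun x} :=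
  (j.tr hM (Df.isSing 0 1) ![{x}, x]).1 rfl

theorem pairMem {x y f : ZFSet} (h : x.pair y ∈ f) : (j.toFun x).pair (j.toFun y) ∈ j.toFun f := by
  rw [← j.pair hM, j.mem_iff hM]
  exact h

theorem mem_of_mem {x y : ZFSet} (h : y ∈ j.toFun x) : y ∈ M := hM _ (j.maps _ trivial) _ h

theorem empty : j.toFun ∅ = ∅ := by
  have : ∀ x ∈ j.toFun ∅, x ≠ x :=
    (j.tr hM (Df.ball 0 (P := fun _ _ x => x ≠ x) (Df.eq _ _).not) ![∅]).1
      (fun x hx => (ZFSet.notMem_empty x hx).elim)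
  rw [ZFSet.eq_empty]
  exact fun x hx => this x hx rfl

theorem isOrd {x : ZFSet} (h : IsOrd x) : IsOrd (j.toFun x) :=
  (j.tr hM (Df.isOrd 0) ![x]).1 h

theorem rank_le {x y : ZFSet} (h : x.rank ≤ y.rank) : (j.toFun x).rank ≤ (j.toFun y).rank := by
  obtain ⟨r, h1, h2⟩ := exists_sim h
  have := (j.tr hM ((Df.pairMem 0 1 2).and (Df.simR 0)) ![r, x, y]).1 ⟨h1, h2⟩
  exact rank_le_of_sim this.2 _ _ this.1

theorem le_rank (x : ZFSet) : x.rank ≤ (j.toFun x).rank := by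
  induction x using ZFSet.inductionOn with
  | _ x ih =>
    rw [ZFSet.rank_le_iff]
    intro y hy
    exact (ih y hy).trans_lt (ZFSet.rank_lt_of_mem ((j.mem_iff hM _ _).2 hy))

theorem mem_V {t y : ZFSet} (hy : y ∈ M) : y ∈ j.toFun (VV t) ↔ y.rank < (j.toFun t).rank := by
  have h1 : ∀ y ∈ M, (y ∈ j.toFun (VV t) ↔ ∃ z ∈ j.toFun t, ∃ r ∈ M, y.pair z ∈ r ∧ SimR r) := by
    refine (j.tr hM (n := 2) (P := fun C v => ∀ y ∈ C, (y ∈ v 0 ↔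
      ∃ z ∈ v 1, ∃ r ∈ C, y.pair z ∈ r ∧ SimR r)) ?_ ![VV t, t]).1 ?_
    · exact Df.all (P := fun C v y => y ∈ v 0 ↔ ∃ z ∈ v 1, ∃ r ∈ C, y.pair z ∈ r ∧ SimR r)
        ((Df.mem _ _).iff (Df.bex _ (P := fun C w z => ∃ r ∈ C, (w (Fin.last _)).pair z ∈ r ∧ SimR r)
          (Df.ex (P := fun C w r => (w (Fin.last _).castSucc).pair (w (Fin.last _)) ∈ r ∧ SimR r)
          ((Df.pairMem _ _ _).and (Df.simR _)))))
    · intro y _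
      change y ∈ VV t ↔ ∃ z ∈ t, ∃ r ∈ Set.univ, y.pair z ∈ r ∧ SimR r
      rw [mem_VV, ZFSet.lt_rank_iff]
      refine exists_congr fun z => and_congr_right fun _ => ?_
      constructor
      · intro h
        obtain ⟨r, hr⟩ := exists_sim h
        exact ⟨r, trivial, hr⟩
      · rintro ⟨r, _, h, h'⟩
        exact rank_le_of_sim h' _ _ h
  have h2 : ∀ x ∈ M, ∀ y ∈ M, ∃ r ∈ M, (x.pair y ∈ r ∧ SimR r) ∨
      ∃ x' ∈ x, (y.pair x' ∈ r ∧ SimR r) := by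
    refine (j.tr hM (n := 0) (P := fun C v => ∀ x ∈ C, ∀ y ∈ C, ∃ r ∈ C, (x.pair y ∈ r ∧ SimR r) ∨
      ∃ x' ∈ x, (y.pair x' ∈ r ∧ SimR r)) ?_ ![]).1 ?_
    · exact Df.all (P := fun C v x => ∀ y ∈ C, ∃ r ∈ C, (x.pair y ∈ r ∧ SimR r) ∨
          ∃ x' ∈ x, (y.pair x' ∈ r ∧ SimR r))
        (Df.all (P := fun C w y => ∃ r ∈ C, ((w (Fin.last _)).pair y ∈ r ∧ SimR r) ∨
          ∃ x' ∈ w (Fin.last _), (y.pair x' ∈ r ∧ SimR r))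
        (Df.ex (P := fun C w r => ((w (Fin.last _).castSucc).pair (w (Fin.last _)) ∈ r ∧ SimR r) ∨
          ∃ x' ∈ w (Fin.last _).castSucc, ((w (Fin.last _)).pair x' ∈ r ∧ SimR r))
        (((Df.pairMem _ _ _).and (Df.simR _)).or (Df.bex _
          (P := fun C w x' => ((w (Fin.last _).castSucc).pair x' ∈ w (Fin.last _) ∧
            SimR (w (Fin.last _))))
          ((Df.pairMem _ _ _).and (Df.simR _))))))
    · intro x _ y _
      rcases le_or_gt x.rank y.rank with h | h
      · obtain ⟨r, hr⟩ := exists_sim h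
        exact ⟨r, trivial, Or.inl hr⟩
      · obtain ⟨x', hx', h⟩ := ZFSet.lt_rank_iff.1 h
        obtain ⟨r, hr⟩ := exists_sim h
        exact ⟨r, trivial, Or.inr ⟨x', hx', hr⟩⟩
  rw [h1 y hy, ZFSet.lt_rank_iff]
  refine exists_congr fun z => and_congr_right fun hz => ?_
  constructor
  · rintro ⟨r, _, h, h'⟩
    exact rank_le_of_sim h' _ _ h
  · intro h
    obtain ⟨r, hr, h' | ⟨x', hx', h'⟩⟩ := h2 y hy z (j.mem_of_mem hM hz)
    · exact ⟨r, hr, h'⟩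
    · have := rank_le_of_sim h'.2 _ _ h'.1
      exact absurd ((this.trans_lt (ZFSet.rank_lt_of_mem hx')).trans_le h) (lt_irrefl _)

/-- Sets of rank below the critical point are fixed. -/
theorem fix {κ : ZFSet.{u}} (hκ : IsCrit j κ) (o : Ordinal) :
    ∀ x : ZFSet, x.rank = o → x.rank < κ.rank → j.toFun x = x := by
  induction o using Ordinal.induction with
  | _ o ih =>
    intro x hx hlt
    subst hx
    -- an element of `κ` with the same rank
    have hex : ∃ ξ ∈ κ, ξ.rank = x.rank := by
      have hne : ∃ ξ, ξ ∈ κ ∧ x.rank ≤ ξ.rank := by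
        obtain ⟨y, hy, h⟩ := ZFSet.lt_rank_iff.1 hlt
        exact ⟨y, hy, h⟩
      obtain ⟨ξ, ⟨h1, h2⟩, hmin⟩ := (InvImage.wf ZFSet.rank wellFounded_lt).has_min
        {ξ | ξ ∈ κ ∧ x.rank ≤ ξ.rank} hne
      refine ⟨ξ, h1, le_antisymm ?_ h2⟩
      by_contra hcon
      rw [not_le] at hcon
      obtain ⟨z, hz, hle⟩ := ZFSet.lt_rank_iff.1 hcon
      exact hmin z ⟨hκ.1.1 _ h1 hz, hle⟩ (ZFSet.rank_lt_of_mem hz)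
    obtain ⟨ξ, hξ, hr⟩ := hex
    have hjr : (j.toFun x).rank ≤ x.rank := by
      have := j.rank_le hM hr.ge
      rwa [hκ.2.2 ξ hξ, hr] at this
    ext y
    constructor
    · intro hy
      have hlt' := (ZFSet.rank_lt_of_mem hy).trans_le hjr
      have := ih _ hlt' y rfl (hlt'.trans hlt)
      rwa [← this, j.mem_iff hM] at hy
    · intro hy
      have hlt' := ZFSet.rank_lt_of_mem hy
      rw [← ih _ hlt' y rfl (hlt'.trans hlt), j.mem_iff hM]
      exact hy

theorem fix' {κ : ZFSet.{u}} (hκ : IsCrit j κ) {x : ZFSet} (h : x.rank < κ.rank) : j.toFun x = x :=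
  j.fix hM hκ _ x rfl h

end ElemEmb

/-! ### Reflection -/

/-- `U` is a rank-initial segment which is an elementary substructure of the universe. -/
def Refl (U : ZFSet) : Prop :=
  VV U = U ∧ ∀ (n : ℕ) (φ : Fml n) (v : Fin n → ZFSet), (∀ i, v i ∈ U) →
    (Fml.Realize {y | y ∈ U} φ v ↔ Fml.Realize Set.univ φ v)

theorem reflStep (o : Ordinal.{u}) : ∃ o' : Ordinal.{u}, o ≤ o' ∧
    ∀ (n : ℕ) (φ : Fml (n + 1)) (v : Fin n → ZFSet.{u}), (∀ i, v i ∈ ZFSet.vonNeumann o) →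
      (∃ x, Fml.Realize Set.univ φ (Fin.snoc v x)) →
      ∃ x ∈ ZFSet.vonNeumann o', Fml.Realize Set.univ φ (Fin.snoc v x) := by
  classical
  let X : ZFSet.{u} := ZFSet.vonNeumann o
  let ι := Σ n : ℕ, Fml (n + 1) × (Fin n → Shrink.{u} X)
  let val : ∀ {n : ℕ}, (Fin n → Shrink.{u} X) → Fin n → ZFSet.{u} :=
    fun w i => ((equivShrink.{u} X).symm (w i)).1
  let wit : ι → ZFSet.{u} := fun p =>
    if h : ∃ x, Fml.Realize Set.univ p.2.1 (Fin.snoc (val p.2.2) x) then h.choose else ∅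
  refine ⟨max o (ZFSet.range wit).rank, le_max_left _ _, ?_⟩
  intro n φ v hv hx
  let w : Fin n → Shrink.{u} X := fun i => equivShrink.{u} X ⟨v i, hv i⟩
  have hw : val w = v := by
    funext i
    simp [val, w]
  have hx' : ∃ x, Fml.Realize Set.univ φ (Fin.snoc (val w) x) := by rw [hw]; exact hx
  refine ⟨wit ⟨n, φ, w⟩, ?_, ?_⟩
  · rw [ZFSet.mem_vonNeumann]
    exact lt_max_of_lt_right (ZFSet.rank_lt_of_mem (ZFSet.mem_range_self _))
  · have : wit ⟨n, φ, w⟩ = hx'.choose := dif_pos hx'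
    rw [this]
    have := hx'.choose_spec
    convert this using 2
    exact hw.symm

theorem exists_refl (x : ZFSet.{u}) : ∃ U, Refl U ∧ x ∈ U := by
  choose F hF1 hF2 using reflStep.{u}
  let s : ℕ → Ordinal.{u} := fun n => F^[n] (x.rank + 1)
  have hs : ∀ n, s (n + 1) = F (s n) := fun n => Function.iterate_succ_apply' F n _
  have hmono : Monotone s := monotone_nat_of_le_succ (fun n => by rw [hs]; exact hF1 _)
  set O : Ordinal.{u} := ⨆ n, s n with hO
  have hle : ∀ n, s n ≤ O := fun n => Ordinal.le_iSup s n
  have hlt : ∀ a, a < O → ∃ n, a < s n := fun a ha => (Ordinal.lt_iSup_iff).1 ha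
  refine ⟨ZFSet.vonNeumann O, ⟨?_, ?_⟩, ?_⟩
  · unfold VV
    rw [ZFSet.rank_vonNeumann]
  · intro n φ
    induction φ with
    | mem i j => intro v hv; rfl
    | eq i j => intro v hv; rfl
    | not φ ih => intro v hv; exact not_congr (ih v hv)
    | and φ ψ ih ih' => intro v hv; exact and_congr (ih v hv) (ih' v hv)
    | @ex n φ ih =>
      intro v hv
      have hsn : ∀ y ∈ ZFSet.vonNeumann O, ∀ i, (Fin.snoc v y : Fin (n + 1) → ZFSet) i ∈
          ZFSet.vonNeumann O := by
        intro y hy i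
        refine Fin.lastCases ?_ (fun i => ?_) i
        · simpa using hy
        · simpa using hv i
      constructor
      · rintro ⟨y, hy, h⟩
        exact ⟨y, trivial, (ih _ (hsn y hy)).1 h⟩
      · rintro ⟨y, _, h⟩
        have : ∃ k, ∀ i, v i ∈ ZFSet.vonNeumann (s k) := by
          have h1 : ∀ i, ∃ k, v i ∈ ZFSet.vonNeumann (s k) := by
            intro i
            obtain ⟨k, hk⟩ := hlt _ (ZFSet.mem_vonNeumann.1 (hv i))
            exact ⟨k, ZFSet.mem_vonNeumann.2 hk⟩
          choose k hk using h1
          refine ⟨Finset.univ.sup k, fun i => ?_⟩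
          have := hmono (Finset.le_sup (f := k) (Finset.mem_univ i))
          exact ZFSet.vonNeumann_subset_vonNeumann_iff.2 this (hk i)
        obtain ⟨k, hk⟩ := this
        obtain ⟨z, hz, hz'⟩ := hF2 (s k) n φ v hk ⟨y, h⟩
        rw [← hs] at hz
        have hzO := ZFSet.vonNeumann_subset_vonNeumann_iff.2 (hle (k + 1)) hz
        exact ⟨z, hzO, (ih _ (hsn z hzO)).2 hz'⟩
  · rw [ZFSet.mem_vonNeumann]
    exact (Order.lt_succ _).trans_le (hle 0)

theorem Refl.trans {U : ZFSet} (h : Refl U) : U.IsTransitive := by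
  rw [← h.1]
  exact VV_trans U

theorem exists_refl_fin {k : ℕ} (x : Fin k → ZFSet.{u}) : ∃ U, Refl U ∧ ∀ i, x i ∈ U := by
  obtain ⟨U, hU, h⟩ := exists_refl (ZFSet.range (fun i : ULift.{u} (Fin k) => x i.down))
  exact ⟨U, hU, fun i => hU.trans _ h (ZFSet.mem_range.2 ⟨⟨i⟩, rfl⟩)⟩

theorem ElemEmb.cofinal {M : Set ZFSet.{u}} (j : ElemEmb (Set.univ : Set ZFSet.{u}) M)
    (hM : TransClass M) {y : ZFSet.{u}}
    (hy : y ∈ M) : ∃ U, Refl U ∧ y ∈ j.toFun U := by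
  obtain ⟨U, hU, h⟩ := exists_refl y
  refine ⟨U, hU, ?_⟩
  have := (j.mem_V hM (t := U) hy).2 ((ZFSet.rank_lt_of_mem h).trans_le (j.le_rank hM U))
  rwa [hU.1] at this


end Part2

section Part3

/-! ### Elementary chains, Łoś, and images of families of embeddings -/

/-- `s` is a `φ`-elementary substructure of `t`. -/
def Elm {n : ℕ} (φ : Fml n) (s t : ZFSet.{u}) : Prop :=
  ∀ x : Fin n → ZFSet.{u}, (∀ i, x i ∈ s) →
    (Fml.Realize {y | y ∈ s} φ x ↔ Fml.Realize {y | y ∈ t} φ x)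

theorem chain {ι : Type*} (S : ι → ZFSet.{u})
    (hdir : ∀ a b, ∃ c, S a ⊆ S c ∧ S b ⊆ S c ∧ ∀ (n : ℕ) (φ : Fml n), Elm φ (S a) (S c))
    {n : ℕ} (φ : Fml n) : ∀ (a : ι) (v : Fin n → ZFSet.{u}), (∀ i, v i ∈ S a) →
      (Fml.Realize {y | y ∈ S a} φ v ↔ Fml.Realize {y | ∃ b, y ∈ S b} φ v) := by
  induction φ with
  | mem i j => intro a v hv; rfl
  | eq i j => intro a v hv; rfl
  | not φ ih => intro a v hv; exact not_congr (ih a v hv)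
  | and φ ψ ih ih' => intro a v hv; exact and_congr (ih a v hv) (ih' a v hv)
  | @ex n φ ih =>
    intro a v hv
    have hsn : ∀ c, (∀ i, v i ∈ S c) → ∀ y ∈ S c, ∀ i, (Fin.snoc v y : Fin (n + 1) → ZFSet) i ∈
        S c := by
      intro c hc y hy i
      refine Fin.lastCases ?_ (fun i => ?_) i
      · simpa using hy
      · simpa using hc i
    constructor
    · rintro ⟨y, hy, h⟩
      exact ⟨y, ⟨a, hy⟩, (ih a _ (hsn a hv y hy)).1 h⟩
    · rintro ⟨y, ⟨b, hy⟩, h⟩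
      obtain ⟨c, hac, hbc, helm⟩ := hdir a b
      refine (helm _ (.ex φ) v hv).2 ⟨y, hbc hy, (ih c _ (hsn c (fun i => hac (hv i)) y (hbc hy))).2 h⟩

theorem Df.elm {m n : ℕ} (φ : Fml n) (s t : Fin m) : Df (fun _ v => Elm φ (v s) (v t)) := by
  refine Df.congr (Df.allN (k := n) (P := fun C v x => (∀ i, x i ∈ v s) →
    (Fml.Realize {y | y ∈ v s} φ x ↔ Fml.Realize {y | y ∈ v t} φ x))
    ((Df.forallFin (fun i => Df.mem _ _)).imp ((Df.sat φ _ _).iff (Df.sat φ _ _)))) ?_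
  intro C hC v hv
  exact ⟨fun h x hx => h x (fun i => hC _ (hv s) _ (hx i)) hx, fun h x _ hx => h x hx⟩

section los

variable {M : Set ZFSet.{u}} (j : ElemEmb (Set.univ : Set ZFSet.{u}) M) (I b : ZFSet.{u})

/-- The value at `b` of the `j`-image of the function `f` on `I`. -/
noncomputable def ev (f : ZFSet.{u} → ZFSet.{u}) : ZFSet.{u} :=
  Classical.epsilon (fun y => b.pair y ∈ j.toFun (gr I f))

variable {I b} (hM : TransClass M) (hb : b ∈ j.toFun I)
include hM hb

theorem ev_spec (f : ZFSet.{u} → ZFSet.{u}) : b.pair (ev j I b f) ∈ j.toFun (gr I f) := by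
  have h : IsFuncOn (j.toFun I) (j.toFun (gr I f)) :=
    (j.tr hM (Df.isFuncOn 0 1) ![I, gr I f]).1 (isFuncOn_gr I f)
  exact Classical.epsilon_spec (h.2 b hb).exists

theorem ev_unique {f : ZFSet.{u} → ZFSet.{u}} {y : ZFSet.{u}}
    (hy : b.pair y ∈ j.toFun (gr I f)) : ev j I b f = y := by
  have h : IsFuncOn (j.toFun I) (j.toFun (gr I f)) :=
    (j.tr hM (Df.isFuncOn 0 1) ![I, gr I f]).1 (isFuncOn_gr I f)
  exact (h.2 b hb).unique (ev_spec j hM hb f) hy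

theorem ev_mem (f : ZFSet.{u} → ZFSet.{u}) : ev j I b f ∈ M :=
  (hM.of_pair (j.maps _ trivial) (ev_spec j hM hb f)).2

theorem ev_const (x : ZFSet.{u}) : ev j I b (fun _ => x) = j.toFun x := by
  refine ev_unique j hM hb ?_
  have h0 : ∀ a ∈ I, a.pair x ∈ gr I (fun _ => x) := fun a ha => mem_gr.2 ⟨ha, rfl⟩
  have : ∀ a ∈ j.toFun I, a.pair (j.toFun x) ∈ j.toFun (gr I (fun _ => x)) :=
    (j.tr hM (n := 3) (P := fun _ v => ∀ a ∈ v 0, a.pair (v 1) ∈ v 2)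
      (Df.ball 0 (P := fun _ v a => a.pair (v 1) ∈ v 2) (Df.pairMem _ _ _))
      ![I, x, gr I (fun _ => x)]).1 h0
  exact this b hb

theorem ev_id : ev j I b (fun a => a) = b := by
  refine ev_unique j hM hb ?_
  have h0 : ∀ a ∈ I, a.pair a ∈ gr I (fun a => a) := fun a ha => mem_gr.2 ⟨ha, rfl⟩
  have : ∀ a ∈ j.toFun I, a.pair a ∈ j.toFun (gr I (fun a => a)) :=
    (j.tr hM (n := 2) (P := fun _ v => ∀ a ∈ v 0, a.pair a ∈ v 1)
      (Df.ball 0 (P := fun _ v a => a.pair a ∈ v 1) (Df.pairMem _ _ _))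
      ![I, gr I (fun a => a)]).1 h0
  exact this b hb

theorem los {n : ℕ} {P : Set ZFSet.{u} → (Fin n → ZFSet.{u}) → Prop} (h : Df P)
    (f : Fin n → ZFSet.{u} → ZFSet.{u}) (H : ∀ a ∈ I, P Set.univ (fun i => f i a)) :
    P M (fun i => ev j I b (f i)) := by
  have hQ : Df (fun C (w : Fin (n + 1) → ZFSet.{u}) => ∀ a ∈ w (Fin.last n),
      ∀ y : Fin n → ZFSet.{u}, (∀ i, y i ∈ C) → (∀ i, a.pair (y i) ∈ w i.castSucc) → P C y) := by
    refine Df.ball _ (P := fun C w a => ∀ y : Fin n → ZFSet.{u}, (∀ i, y i ∈ C) →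
      (∀ i, a.pair (y i) ∈ w i.castSucc) → P C y) ?_
    refine Df.allN (k := n) (P := fun C w y => (∀ i, (w (Fin.last _)).pair (y i) ∈
      w i.castSucc.castSucc) → P C y) ?_
    exact (Df.forallFin (fun i => Df.pairMem _ _ _)).imp (h.rename _)
  have := (j.tr hM hQ (Fin.snoc (fun i => gr I (f i)) I)).1 (by
    intro a ha y _ hy
    simp only [Fin.snoc_last] at ha
    have e : y = fun i => f i a := by
      funext i
      have := hy i
      simp only [Fin.snoc_castSucc] at this
      exact (mem_gr.1 this).2.symm
    rw [e]
    exact H a ha)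
  refine this b (by simpa using hb) _ (fun i => ev_mem j hM hb _) (fun i => ?_)
  simpa using ev_spec j hM hb (f i)

theorem image_emb (N : ZFSet.{u} → Set ZFSet.{u}) (hN : ∀ a, TransClass (N a))
    (k : ∀ a, ElemEmb (Set.univ : Set ZFSet.{u}) (N a)) :
    ∃ N' : Set ZFSet.{u}, TransClass N' ∧ ∃ J : ElemEmb (Set.univ : Set ZFSet.{u}) N',
      (∀ x, J.toFun x = ev j I b (fun a => (k a).toFun x)) ∧
      ∀ y : ZFSet.{u} → ZFSet.{u}, (∀ a ∈ I, y a ∈ N a) → ev j I b y ∈ N' := by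
  set F : ZFSet.{u} → ZFSet.{u} := fun x => ev j I b (fun a => (k a).toFun x) with hF
  let S : {U : ZFSet.{u} // Refl U} → ZFSet.{u} := fun U => F U.1
  set N' : Set ZFSet.{u} := {y | ∃ U, y ∈ S U} with hN'
  have hmem : ∀ x y, x ∈ y → F x ∈ F y := fun x y h =>
    los j hM hb (Df.mem 0 1) ![fun a => (k a).toFun x, fun a => (k a).toFun y]
      (fun a _ => ((k a).mem_iff (hN a) _ _).2 h)
  have hsub : ∀ x y, x ⊆ y → F x ⊆ F y := fun x y h =>
    los j hM hb (Df.sub 0 1) ![fun a => (k a).toFun x, fun a => (k a).toFun y]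
      (fun a _ => (k a).sub (hN a) _ _ h)
  have htr : ∀ x : ZFSet.{u}, x.IsTransitive → (F x).IsTransitive := fun x h =>
    los j hM hb (Df.isTrans 0) ![fun a => (k a).toFun x]
      (fun a _ => ((k a).tr (hN a) (Df.isTrans 0) ![x]).1 h)
  have hdir : ∀ a b, ∃ c, S a ⊆ S c ∧ S b ⊆ S c ∧ ∀ (n : ℕ) (φ : Fml n), Elm φ (S a) (S c) := by
    rintro ⟨U, hU⟩ ⟨U', hU'⟩
    obtain ⟨U'', hU'', h⟩ := exists_refl_fin ![U, U']
    have h0 : U ∈ U'' := h 0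
    have h1 : U' ∈ U'' := h 1
    refine ⟨⟨U'', hU''⟩, hsub _ _ (hU''.trans _ h0), hsub _ _ (hU''.trans _ h1), fun n φ => ?_⟩
    refine los j hM hb (Df.elm φ 0 1) ![fun a => (k a).toFun U, fun a => (k a).toFun U'']
      (fun a _ => ((k a).tr (hN a) (Df.elm φ 0 1) ![U, U'']).1 ?_)
    intro x hx
    exact (hU.2 n φ x hx).trans (hU''.2 n φ x (fun i => hU''.trans _ h0 (hx i))).symm
  have hone : ∀ (U : ZFSet.{u}) {n : ℕ} (φ : Fml n) (v : Fin n → ZFSet.{u}),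
      Fml.Realize {y | y ∈ U} φ v → Fml.Realize {y | y ∈ F U} φ (fun i => F (v i)) := by
    intro U n φ v h
    have hD := Df.sat φ (Fin.last n) (fun i : Fin n => i.castSucc)
    have := los j hM hb hD (Fin.snoc (fun i a => (k a).toFun (v i)) (fun a => (k a).toFun U))
      (fun a _ => by
        have := ((k a).tr (hN a) hD (Fin.snoc v U)).1 (by simpa using h)
        simpa using this)
    simpa using this
  refine ⟨N', ?_, ⟨F, ?_, ?_⟩, fun x => rfl, ?_⟩
  · rintro x ⟨U, hU⟩ y hy
    exact ⟨U, htr _ U.2.trans _ hU hy⟩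
  · intro x _
    obtain ⟨U, hU, h⟩ := exists_refl x
    exact ⟨⟨U, hU⟩, hmem _ _ h⟩
  · intro n φ v _
    obtain ⟨U, hU, h⟩ := exists_refl_fin v
    rw [← hU.2 n φ v h, ← chain S hdir φ ⟨U, hU⟩ _ (fun i => hmem _ _ (h i))]
    refine ⟨hone U φ v, fun h => ?_⟩
    by_contra hcon
    exact hone U (.not φ) v hcon h
  · intro y hy
    have : ∀ a, ∃ U, a ∈ I → Refl U ∧ y a ∈ (k a).toFun U := by
      intro a
      by_cases ha : a ∈ I
      · obtain ⟨U, hU⟩ := (k a).cofinal (hN a) (hy a ha)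
        exact ⟨U, fun _ => hU⟩
      · exact ⟨∅, fun h => (ha h).elim⟩
    choose U hU using this
    obtain ⟨W, hW, h⟩ := exists_refl (img I U)
    refine ⟨⟨W, hW⟩, los j hM hb (Df.mem 0 1) ![y, fun a => (k a).toFun W] (fun a ha => ?_)⟩
    have hUW : U a ∈ W := hW.trans _ h (mem_img.2 ⟨a, ha, rfl⟩)
    exact (k a).sub (hN a) _ _ (hW.trans _ hUW) (hU a ha).2

end los


end Part3

section Part4

/-! ### Ordinals -/

theorem isOrd_iff {x : ZFSet.{u}} : IsOrd x ↔ x.IsOrdinal :=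
  (ZFSet.isOrdinal_iff_forall_mem_isTransitive).symm

theorem IsOrd.mem {x y : ZFSet.{u}} (h : IsOrd x) (hy : y ∈ x) : IsOrd y :=
  isOrd_iff.2 ((isOrd_iff.1 h).mem hy)

theorem IsOrd.lt_iff {x y : ZFSet.{u}} (hx : IsOrd x) (hy : IsOrd y) :
    x ∈ y ↔ x.rank < y.rank :=
  ((isOrd_iff.1 hx).rank_lt_iff_mem (isOrd_iff.1 hy)).symm

theorem IsOrd.eq_iff {x y : ZFSet.{u}} (hx : IsOrd x) (hy : IsOrd y) :
    x = y ↔ x.rank = y.rank :=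
  ((isOrd_iff.1 hx).rank_inj (isOrd_iff.1 hy)).symm

theorem IsOrd.le_iff {x y : ZFSet.{u}} (hx : IsOrd x) (hy : IsOrd y) :
    oLe x y ↔ x.rank ≤ y.rank := by
  unfold oLe
  rw [hx.lt_iff hy, hx.eq_iff hy, le_iff_lt_or_eq]

theorem IsOrd.tri {x y : ZFSet.{u}} (hx : IsOrd x) (hy : IsOrd y) : x ∈ y ∨ oLe y x := by
  rw [hx.lt_iff hy, hy.le_iff hx]
  exact lt_or_ge _ _

theorem IsOrd.succ {x : ZFSet.{u}} (hx : IsOrd x) : IsOrd (insert x x) :=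
  isOrd_iff.2 (ZFSet.isOrdinal_succ (isOrd_iff.1 hx))

theorem rank_insert_self (x : ZFSet.{u}) : (insert x x : ZFSet.{u}).rank = Order.succ x.rank := by
  rw [ZFSet.rank_insert]
  exact max_eq_left (Order.le_succ _)

theorem rank_VV (t : ZFSet.{u}) : (VV t).rank = t.rank := ZFSet.rank_vonNeumann _

section crit

variable {M : Set ZFSet.{u}} (j : ElemEmb (Set.univ : Set ZFSet.{u}) M) (hM : TransClass M)
  {κ : ZFSet.{u}} (hκ : IsCrit j κ)

include hM in
theorem rank_lt_j {x y : ZFSet.{u}} (h : x.rank < y.rank) :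
    (j.toFun x).rank < (j.toFun y).rank := by
  obtain ⟨z, hz, hle⟩ := ZFSet.lt_rank_iff.1 h
  exact (j.rank_le hM hle).trans_lt (ZFSet.rank_lt_of_mem ((j.mem_iff hM _ _).2 hz))

include hM in
theorem ord_of_mem_j {x y : ZFSet.{u}} (hx : IsOrd x) (h : y ∈ j.toFun x) : IsOrd y :=
  (j.isOrd hM hx).mem h

include hM hκ

theorem crit_mem : κ ∈ j.toFun κ := by
  rw [hκ.1.lt_iff (j.isOrd hM hκ.1)]
  refine lt_of_le_of_ne (j.le_rank hM κ) fun h => hκ.2.1 ?_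
  exact ((hκ.1.eq_iff (j.isOrd hM hκ.1)).2 h).symm

theorem no_inj {X : ZFSet.{u}} (hX : j.toFun X = X) (hX' : ∀ x ∈ X, j.toFun x = x) :
    ¬ SetLeIn Set.univ κ X := by
  rintro ⟨f, _, hf, hm, hi⟩
  have h1 : IsFuncOn (j.toFun κ) (j.toFun f) := (j.tr hM (Df.isFuncOn 0 1) ![κ, f]).1 hf
  have h2 : MapsInto (j.toFun f) (j.toFun X) := (j.tr hM (Df.mapsInto 0 1) ![f, X]).1 hm
  have h3 : InjFun (j.toFun f) := (j.tr hM (Df.injFun 0) ![f]).1 hi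
  obtain ⟨y, hy, _⟩ := h1.2 κ (crit_mem j hM hκ)
  have hyX : y ∈ X := by rw [← hX]; exact h2 _ _ hy
  have hjy := hX' y hyX
  have h4 : (∃ x ∈ κ, x.pair y ∈ f) ↔ ∃ x ∈ j.toFun κ, x.pair (j.toFun y) ∈ j.toFun f :=
    j.tr hM (n := 3) (P := fun _ v => ∃ x ∈ v 0, x.pair (v 1) ∈ v 2)
      (Df.bex 0 (P := fun _ v x => x.pair (v 1) ∈ v 2) (Df.pairMem _ _ _)) ![κ, y, f]
  rw [hjy] at h4
  obtain ⟨x, hx, hxy⟩ := h4.2 ⟨κ, crit_mem j hM hκ, hy⟩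
  have h5 := j.pairMem hM hxy
  rw [hjy, hκ.2.2 x hx] at h5
  have h6 := h3 _ _ _ h5 hy
  rw [h6] at hx
  exact ZFSet.mem_irrefl _ hx

theorem crit_card : IsCard κ := by
  refine ⟨hκ.1, fun α hα => no_inj j hM hκ (hκ.2.2 α hα) (fun x hx => hκ.2.2 x ?_)⟩
  exact hκ.1.1 _ hα hx

theorem crit_VV {l : ZFSet.{u}} (hl : l ∈ κ) : ¬ SetLeIn Set.univ κ (VV l) := by
  have hr := ZFSet.rank_lt_of_mem hl
  refine no_inj j hM hκ (j.fix' hM hκ (by rwa [rank_VV])) (fun x hx => j.fix' hM hκ ?_)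
  exact (mem_VV.1 hx).trans hr

theorem crit_ne : (∅ : ZFSet.{u}) ∈ κ := by
  have h0 : IsOrd (∅ : ZFSet.{u}) := isOrd_iff.2 ZFSet.isOrdinal_empty
  rw [h0.lt_iff hκ.1, ZFSet.rank_empty, pos_iff_ne_zero]
  intro h
  have h1 := (h0.eq_iff hκ.1).2 (by rw [ZFSet.rank_empty, h])
  apply hκ.2.1
  rw [← h1]
  exact j.empty hM

theorem crit_succ {x : ZFSet.{u}} (hx : x ∈ κ) : (insert x x : ZFSet.{u}) ∈ κ := by
  have hxo := hκ.1.mem hx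
  rcases hxo.succ.tri hκ.1 with h | h
  · exact h
  exfalso
  rcases h with h | h
  · rw [ZFSet.mem_insert_iff] at h
    have h1 := ZFSet.rank_lt_of_mem hx
    rcases h with h | h
    · rw [h] at h1
      exact lt_irrefl _ h1
    · exact lt_irrefl _ (h1.trans (ZFSet.rank_lt_of_mem h))
  · have h1 : ∀ y ∈ j.toFun κ, y ∈ j.toFun x ∨ y = j.toFun x :=
      (j.tr hM (n := 2) (P := fun _ v => ∀ y ∈ v 0, y ∈ v 1 ∨ y = v 1)
        (Df.ball 0 (P := fun _ v y => y ∈ v 1 ∨ y = v 1) ((Df.mem _ _).or (Df.eq _ _)))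
        ![κ, x]).1 (fun y (hy : y ∈ κ) => by
          change y ∈ x ∨ y = x
          rw [h, ZFSet.mem_insert_iff] at hy
          tauto)
    have h2 := h1 κ (crit_mem j hM hκ)
    rw [hκ.2.2 x hx] at h2
    have h3 := ZFSet.rank_lt_of_mem hx
    rcases h2 with h2 | h2
    · exact lt_irrefl _ (h3.trans (ZFSet.rank_lt_of_mem h2))
    · rw [h2] at h3
      exact lt_irrefl _ h3

omit hM hκ in
/-- A cardinal above a critical point is a limit ordinal. -/
theorem card_succ (hM : TransClass M) (hκ : IsCrit j κ) {δ : ZFSet.{u}} (hδ : IsCard δ)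
    (hκδ : κ ∈ δ) {γ : ZFSet.{u}}
    (hγ : γ ∈ δ) : (insert γ γ : ZFSet.{u}) ∈ δ := by
  classical
  have hγo := hδ.1.mem hγ
  rcases hγo.succ.tri hδ.1 with h | h
  · exact h
  exfalso
  have hr := ZFSet.rank_lt_of_mem hγ
  have heq : δ = insert γ γ := by
    rw [hδ.1.eq_iff hγo.succ]
    refine le_antisymm ((hδ.1.le_iff hγo.succ).1 h) ?_
    rw [rank_insert_self]
    exact Order.succ_le_of_lt hr
  have hκγ : oLe κ γ := by
    rw [heq, ZFSet.mem_insert_iff] at hκδ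
    exact hκδ.symm
  have hsub : ∀ x ∈ κ, x ∈ γ := by
    rcases hκγ with h | h
    · exact fun x hx => hγo.1 _ h hx
    · exact fun x hx => h ▸ hx
  refine hδ.2 γ hγ ⟨gr δ (fun x => if x = γ then ∅ else if x ∈ κ then insert x x else x),
    trivial, isFuncOn_gr _ _, ?_, ?_⟩
  · intro x y hxy
    obtain ⟨hx, rfl⟩ := mem_gr.1 hxy
    split_ifs with h1 h2
    · exact hsub _ (crit_ne j hM hκ)
    · exact hsub _ (crit_succ j hM hκ h2)
    · rw [heq, ZFSet.mem_insert_iff] at hx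
      exact hx.resolve_left h1
  · intro x x' y hxy hxy'
    obtain ⟨hx, hxe⟩ := mem_gr.1 hxy
    obtain ⟨hx', hxe'⟩ := mem_gr.1 hxy'
    rw [← hxe'] at hxe
    have hne : ∀ z : ZFSet.{u}, (insert z z : ZFSet.{u}) ≠ ∅ := fun z hz =>
      ZFSet.notMem_empty z (hz ▸ ZFSet.mem_insert z z)
    have hne' : ∀ z : ZFSet.{u}, z ∉ κ → z ≠ ∅ := fun z hz h => hz (h ▸ crit_ne j hM hκ)
    split_ifs at hxe with h1 h2 h3 h4 h5 h6 h7 h8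
    · rw [h1, h2]
    · exact absurd hxe.symm (hne _)
    · exact absurd hxe.symm (hne' _ h3)
    · exact absurd hxe (hne _)
    · rw [(hδ.1.mem hx).eq_iff (hδ.1.mem hx')]
      have := congrArg ZFSet.rank hxe
      rw [rank_insert_self, rank_insert_self] at this
      exact Order.succ_injective this
    · exact absurd (hxe ▸ crit_succ j hM hκ h4) h6
    · exact absurd hxe (hne' _ h4)
    · exact absurd (hxe ▸ crit_succ j hM hκ h8) h4
    · exact hxe

end crit

/-! ### Closure under sequences -/

section seq

variable {M : Set ZFSet.{u}} (j : ElemEmb (Set.univ : Set ZFSet.{u}) M) (hM : TransClass M)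
include j hM

theorem pair_closed {x y : ZFSet.{u}} (hx : x ∈ M) (hy : y ∈ M) : x.pair y ∈ M := by
  have : ∀ x ∈ M, ∀ y ∈ M, ∃ z ∈ M, z = x.pair y :=
    (j.tr hM (n := 0) (P := fun C _ => ∀ x ∈ C, ∀ y ∈ C, ∃ z ∈ C, z = x.pair y)
      (Df.all (P := fun C _ x => ∀ y ∈ C, ∃ z ∈ C, z = x.pair y)
        (Df.all (P := fun C w y => ∃ z ∈ C, z = (w (Fin.last _)).pair y)
          (Df.ex (P := fun C w z => z = (w (Fin.last _).castSucc).pair (w (Fin.last _)))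
            (Df.isPair _ _ _)))) ![]).1 (fun x _ y _ => ⟨_, trivial, rfl⟩)
  obtain ⟨z, hz, rfl⟩ := this x hx y hy
  exact hz

theorem img_closed {l : ZFSet.{u}} (hc : SeqClosed M l) (h : ZFSet.{u} → ZFSet.{u})
    (hm : ∀ a ∈ l, h a ∈ M) : img l h ∈ M := by
  have h1 : gr l h ∈ M := hc _ trivial (isFuncOn_gr _ _) (fun x y hxy => by
    obtain ⟨hx, rfl⟩ := mem_gr.1 hxy
    exact hm _ hx)
  have h2 : ∀ f ∈ M, ∃ r ∈ M, ∀ y ∈ M, (y ∈ r ↔ ∃ x ∈ M, x.pair y ∈ f) := by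
    refine (j.tr hM (n := 0) (P := fun C _ => ∀ f ∈ C, ∃ r ∈ C, ∀ y ∈ C,
        (y ∈ r ↔ ∃ x ∈ C, x.pair y ∈ f))
      (Df.all (P := fun C _ f => ∃ r ∈ C, ∀ y ∈ C, (y ∈ r ↔ ∃ x ∈ C, x.pair y ∈ f))
        (Df.ex (P := fun C w r => ∀ y ∈ C, (y ∈ r ↔ ∃ x ∈ C, x.pair y ∈ w (Fin.last _)))
          (Df.all (P := fun C w y => (y ∈ w (Fin.last _) ↔
              ∃ x ∈ C, x.pair y ∈ w (Fin.last _).castSucc))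
            ((Df.mem _ _).iff (Df.ex (P := fun C w x => x.pair (w (Fin.last _)) ∈
              w (Fin.last _).castSucc.castSucc) (Df.pairMem _ _ _)))))) ![]).1 ?_
    intro f _
    refine ⟨ZFSet.sep (fun y => ∃ x : ZFSet.{u}, x.pair y ∈ f) (ZFSet.sUnion (ZFSet.sUnion f)),
      trivial, fun y _ => ?_⟩
    rw [ZFSet.mem_sep]
    constructor
    · rintro ⟨_, x, hx⟩
      exact ⟨x, trivial, hx⟩
    · rintro ⟨x, _, hx⟩
      refine ⟨ZFSet.mem_sUnion.2 ⟨{x, y}, ZFSet.mem_sUnion.2 ⟨_, hx, ?_⟩, ?_⟩, x, hx⟩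
      · simp [ZFSet.pair]
      · simp
  obtain ⟨r, hr, hr'⟩ := h2 _ h1
  have : img l h = r := by
    ext y
    rw [mem_img]
    constructor
    · rintro ⟨a, ha, rfl⟩
      have hp : a.pair (h a) ∈ gr l h := mem_gr.2 ⟨ha, rfl⟩
      exact (hr' _ (hm a ha)).2 ⟨a, (hM.of_pair h1 hp).1, hp⟩
    · intro hy
      obtain ⟨x, _, hx⟩ := (hr' y (hM _ hr _ hy)).1 hy
      exact ⟨x, mem_gr.1 hx⟩
  rw [this]
  exact hr

theorem V_closed {l l' : ZFSet.{u}} (hc : SeqClosed M l') (h : ZFSet.{u} → ZFSet.{u})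
    (hs : ∀ x ∈ VV l, ∃ a ∈ l', h a = x) : VIncl M l := by
  classical
  intro x _ hx
  induction x using ZFSet.inductionOn with
  | _ x ih =>
    have hsub : ∀ y ∈ x, y ∈ VV l := fun y hy => mem_VV.2 ((ZFSet.rank_lt_of_mem hy).trans hx)
    have hin : ∀ y ∈ x, y ∈ M := fun y hy => ih y hy trivial (mem_VV.1 (hsub y hy))
    by_cases hne : ∃ x0, x0 ∈ x
    · obtain ⟨x0, hx0⟩ := hne
      have hg : ∀ a, (if h a ∈ x then h a else x0) ∈ x := by
        intro a
        split_ifs with h1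
        · exact h1
        · exact hx0
      have : img l' (fun a => if h a ∈ x then h a else x0) = x := by
        ext y
        rw [mem_img]
        constructor
        · rintro ⟨a, ha, rfl⟩
          exact hg a
        · intro hy
          obtain ⟨a, ha, rfl⟩ := hs y (hsub y hy)
          exact ⟨a, ha, if_pos hy⟩
      rw [← this]
      exact img_closed j hM hc _ (fun a _ => hin _ (hg a))
    · have : x = ∅ := by
        rw [ZFSet.eq_empty]
        exact fun y hy => hne ⟨y, hy⟩
      rw [this, ← j.empty hM]
      exact j.maps _ trivial

theorem sc_of_closed {κ l : ZFSet.{u}} (hl : l ∈ j.toFun κ) (hc : SeqClosed M l) :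
    WCovers M j.toFun κ l := by
  have hlM : ∀ a ∈ l, a ∈ M := fun a ha => hM _ (j.mem_of_mem hM hl) _ ha
  refine ⟨img l j.toFun, img_closed j hM hc _ (fun a _ => j.maps _ trivial),
    fun a ha => mem_img.2 ⟨a, ha, rfl⟩, l, img l (fun a => (j.toFun a).pair a), hl,
    img_closed j hM hc _ (fun a ha => pair_closed j hM (j.maps _ trivial) (hlM a ha)), ?_, ?_, ?_⟩
  · have key : ∀ x y : ZFSet.{u}, x.pair y ∈ img l (fun a => (j.toFun a).pair a) ↔
        y ∈ l ∧ x = j.toFun y := by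
      intro x y
      rw [mem_img]
      constructor
      · rintro ⟨a, ha, h⟩
        rw [ZFSet.pair_inj] at h
        obtain ⟨rfl, rfl⟩ := h
        exact ⟨ha, rfl⟩
      · rintro ⟨hy, rfl⟩
        exact ⟨y, hy, rfl⟩
    constructor
    · intro p hp
      obtain ⟨a, ha, rfl⟩ := mem_img.1 hp
      exact ⟨_, _, mem_img.2 ⟨a, ha, rfl⟩, rfl⟩
    · intro x hx
      obtain ⟨a, ha, rfl⟩ := mem_img.1 hx
      exact ⟨a, (key _ _).2 ⟨ha, rfl⟩, fun y hy => ((j.eq_iff hM _ _).1 ((key _ _).1 hy).2).symm⟩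
  · intro x y hxy
    obtain ⟨a, ha, h⟩ := mem_img.1 hxy
    rw [ZFSet.pair_inj] at h
    rw [← h.2]
    exact ha
  · intro x x' y h h'
    obtain ⟨a, ha, h⟩ := mem_img.1 h
    obtain ⟨a', ha', h'⟩ := mem_img.1 h'
    rw [ZFSet.pair_inj] at h h'
    rw [← h.1, ← h'.1, h.2, h'.2]

end seq


end Part4

section Part5

/-! ### Consequences of being Vopěnka -/

theorem lim_rank {κ : ZFSet.{u}} (hlim : ∀ ξ ∈ κ, (insert ξ ξ : ZFSet.{u}) ∈ κ) {o : Ordinal.{u}}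
    (ho : o < κ.rank) : Order.succ o < κ.rank := by
  obtain ⟨ξ, hξ, hle⟩ := ZFSet.lt_rank_iff.1 ho
  have h := ZFSet.rank_lt_of_mem (hlim ξ hξ)
  rw [rank_insert_self] at h
  exact (Order.succ_le_succ hle).trans_lt h

theorem rank_pair_le {a b : ZFSet.{u}} {o : Ordinal.{u}} (ha : a.rank < o) (hb : b.rank < o) :
    (a.pair b).rank ≤ Order.succ o := by
  unfold ZFSet.pair
  rw [ZFSet.rank_pair, ZFSet.rank_pair, ZFSet.rank_singleton]
  exact max_le (Order.succ_le_succ (Order.succ_le_of_lt ha))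
    (Order.succ_le_succ (max_le (Order.succ_le_of_lt ha) (Order.succ_le_of_lt hb)))

theorem vop_succ {δ : ZFSet.{u}} (h : Vopenka δ) : ∀ γ ∈ δ, (insert γ γ : ZFSet.{u}) ∈ δ := by
  obtain ⟨κ, hκ, hs⟩ := h.2 ∅ trivial (fun x hx => (ZFSet.notMem_empty x hx).elim)
  obtain ⟨M, _, hM, j, hj, _⟩ := hs κ (Or.inr rfl) hκ
  exact fun γ hγ => card_succ j hM hj h.1 hκ hγ

theorem vop_unb {δ : ZFSet.{u}} (h : Vopenka δ) {α : ZFSet.{u}} (hα : α ∈ δ) :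
    ∃ κ ∈ δ, α ∈ κ ∧ ∃ A, LtSupercompactForIn Set.univ κ δ A := by
  obtain ⟨κ, hκ, hs⟩ := h.2 {α} trivial (fun x hx => by
    rw [ZFSet.mem_singleton] at hx
    rw [hx]
    exact ZFSet.rank_lt_of_mem hα)
  refine ⟨κ, hκ, ?_, _, hs⟩
  have hαo := h.1.1.mem hα
  have hκo := h.1.1.mem hκ
  rcases hαo.tri hκo with hl | hl
  · exact hl
  exfalso
  have hl' := (hκo.le_iff hαo).1 hl
  have hlt : α.rank < (insert α α : ZFSet.{u}).rank := by
    rw [rank_insert_self]; exact Order.lt_succ _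
  obtain ⟨M, _, hM, j, hj, h1, _, h2⟩ := hs (insert α α)
    ((hκo.le_iff hαo.succ).2 (hl'.trans hlt.le)) (vop_succ h α hα)
  have h3 := (h2 α trivial hlt).1 (ZFSet.mem_singleton.2 rfl)
  rw [j.sing hM, ZFSet.mem_singleton] at h3
  have h4 := j.rank_le hM hl'
  rw [← h3] at h4
  exact lt_irrefl _ ((hlt.trans (ZFSet.rank_lt_of_mem h1)).trans_le h4)

theorem vop_size {δ : ZFSet.{u}} (h : Vopenka δ) {l : ZFSet.{u}} (hl : l ∈ δ) :
    ∃ l' ∈ δ, l ∈ l' ∧ ∃ g : ZFSet.{u} → ZFSet.{u}, ∀ x ∈ VV l, ∃ a ∈ l', g a = x := by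
  classical
  obtain ⟨κ, hκ, hlκ, A, hs⟩ := vop_unb h hl
  obtain ⟨M, _, hM, j, hj, _⟩ := hs κ (Or.inr rfl) hκ
  refine ⟨κ, hκ, hlκ, ?_⟩
  have hno := crit_VV j hM hj hlκ
  rcases Function.Embedding.total ↥(VV l) ↥κ with h1 | h1
  · obtain ⟨e⟩ := h1
    refine ⟨fun a => if h : ∃ x : ↥(VV l), (e x).1 = a then h.choose.1 else ∅, fun x hx => ?_⟩
    refine ⟨(e ⟨x, hx⟩).1, (e ⟨x, hx⟩).2, ?_⟩
    have hex : ∃ x' : ↥(VV l), (e x').1 = (e ⟨x, hx⟩).1 := ⟨_, rfl⟩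
    refine (dif_pos hex).trans ?_
    have := e.injective (Subtype.ext hex.choose_spec)
    rw [this]
  · exfalso
    obtain ⟨e⟩ := h1
    have hval : ∀ a (ha : a ∈ κ), (if h : a ∈ κ then (e ⟨a, h⟩).1 else ∅) = (e ⟨a, ha⟩).1 :=
      fun a ha => dif_pos ha
    refine hno ⟨gr κ (fun a => if h : a ∈ κ then (e ⟨a, h⟩).1 else ∅), trivial, isFuncOn_gr _ _,
      ?_, ?_⟩
    · intro x y hxy
      obtain ⟨hx, hy⟩ := mem_gr.1 hxy
      rw [hval x hx] at hy
      rw [← hy]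
      exact (e _).2
    · intro x x' y hxy hxy'
      obtain ⟨hx, hy⟩ := mem_gr.1 hxy
      obtain ⟨hx', hy'⟩ := mem_gr.1 hxy'
      rw [hval x hx] at hy
      rw [hval x' hx'] at hy'
      have := e.injective (Subtype.ext (hy.trans hy'.symm))
      exact congrArg Subtype.val this

theorem sup_strong {δ κ A : ZFSet.{u}} (h : Vopenka δ)
    (hs : LtSupercompactForIn Set.univ κ δ A) : LtStrongFor κ δ A := by
  intro l hκl hl
  obtain ⟨l', hl', hll', g, hg⟩ := vop_size h hl
  have hl'o := h.1.1.mem hl'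
  have hle : oLe κ l' := by
    rcases hκl with hκl | hκl
    · exact Or.inl (hl'o.1 _ hll' hκl)
    · exact Or.inl (hκl ▸ hll')
  obtain ⟨M, hMu, hM, j, hj, h1, h2, h3⟩ := hs l' hle hl'
  refine ⟨M, hMu, hM, j, hj, (j.isOrd hM hj.1).1 _ h1 hll', V_closed j hM h2 g hg, ?_⟩
  intro x _ hx
  exact h3 x trivial (lt_trans hx (ZFSet.rank_lt_of_mem hll'))

theorem sup_SC {δ κ A : ZFSet.{u}} (hs : LtSupercompactForIn Set.univ κ δ A) : LtSC κ δ := by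
  intro l hκl hl
  obtain ⟨M, hMu, hM, j, hj, h1, h2, h3⟩ := hs l hκl hl
  exact ⟨M, hMu, hM, j, hj, h1, sc_of_closed j hM h1 h2⟩

/-! ### Coding two predicates into one -/

/-- The code of a pair of predicates on `V_κ`. -/
noncomputable def enc (κ A C : ZFSet.{u}) : ZFSet.{u} :=
  ZFSet.sep (fun p => (∃ x ∈ A, p = (∅ : ZFSet.{u}).pair x) ∨
    ∃ x ∈ C, p = ({∅} : ZFSet.{u}).pair x) (VV κ)

theorem enc_sub (κ A C : ZFSet.{u}) : SubV (enc κ A C) κ := fun x hx =>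
  mem_VV.1 (ZFSet.mem_sep.1 hx).1

theorem sing_ne_empty' : ({∅} : ZFSet.{u}) ≠ ∅ := by
  intro h
  have h1 : (∅ : ZFSet.{u}) ∈ ({∅} : ZFSet.{u}) := ZFSet.mem_singleton.2 rfl
  rw [h] at h1
  exact ZFSet.notMem_empty _ h1

theorem pair_mem_VV {κ e y : ZFSet.{u}} (hlim : ∀ ξ ∈ κ, (insert ξ ξ : ZFSet.{u}) ∈ κ)
    (he : e ∈ VV κ) (hy : y ∈ VV κ) : e.pair y ∈ VV κ := by
  rw [mem_VV] at *
  have h1 := lim_rank hlim (lim_rank hlim (max_lt he hy))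
  refine (rank_pair_le ?_ ?_).trans_lt h1
  · exact Order.lt_succ_of_le (le_max_left _ _)
  · exact Order.lt_succ_of_le (le_max_right _ _)

theorem mem_enc0 {κ A C y : ZFSet.{u}} (hlim : ∀ ξ ∈ κ, (insert ξ ξ : ZFSet.{u}) ∈ κ)
    (he : ∅ ∈ VV κ) (hy : y ∈ VV κ) : y ∈ A ↔ (∅ : ZFSet.{u}).pair y ∈ enc κ A C := by
  unfold enc
  rw [ZFSet.mem_sep]
  constructor
  · exact fun h => ⟨pair_mem_VV hlim he hy, Or.inl ⟨y, h, rfl⟩⟩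
  · rintro ⟨_, ⟨x, hx, h⟩ | ⟨x, hx, h⟩⟩
    · rw [ZFSet.pair_inj] at h
      rw [h.2]
      exact hx
    · rw [ZFSet.pair_inj] at h
      exact absurd h.1.symm sing_ne_empty'

theorem mem_enc1 {κ A C y : ZFSet.{u}} (hlim : ∀ ξ ∈ κ, (insert ξ ξ : ZFSet.{u}) ∈ κ)
    (he : {∅} ∈ VV κ) (hy : y ∈ VV κ) : y ∈ C ↔ ({∅} : ZFSet.{u}).pair y ∈ enc κ A C := by
  unfold enc
  rw [ZFSet.mem_sep]
  constructor
  · exact fun h => ⟨pair_mem_VV hlim he hy, Or.inr ⟨y, h, rfl⟩⟩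
  · rintro ⟨_, ⟨x, hx, h⟩ | ⟨x, hx, h⟩⟩
    · rw [ZFSet.pair_inj] at h
      exact absurd h.1 sing_ne_empty'
    · rw [ZFSet.pair_inj] at h
      rw [h.2]
      exact hx

theorem decode {κ κ' A' B e : ZFSet.{u}} (hκ : IsOrd κ)
    (hlim : ∀ ξ ∈ κ, (insert ξ ξ : ZFSet.{u}) ∈ κ) (hκ' : κ' ∈ κ) (he : e.rank < κ'.rank)
    (hB : ∀ y ∈ VV κ, (y ∈ B ↔ e.pair y ∈ A')) (hs : LtStrongFor κ' κ A') :
    LtStrongFor κ' κ B := by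
  intro m hκm hm
  have hκ'o := hκ.mem hκ'
  have hmo := hκ.mem hm
  set m1 : ZFSet.{u} := insert m m with hm1
  set m2 : ZFSet.{u} := insert m1 m1 with hm2
  have hm1κ : m1 ∈ κ := hlim _ hm
  have hm2κ : m2 ∈ κ := hlim _ hm1κ
  have hmm1 : m ∈ m1 := ZFSet.mem_insert _ _
  have hm1m2 : m1 ∈ m2 := ZFSet.mem_insert _ _
  have hm2o := hκ.mem hm2κ
  have hmm2 : m ∈ m2 := hm2o.1 _ hm1m2 hmm1
  have hr : m.rank < m2.rank := ZFSet.rank_lt_of_mem hmm2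
  have hle := (hκ'o.le_iff hmo).1 hκm
  obtain ⟨M, hMu, hM, j, hj, h1, h2, h3⟩ := hs m2 ((hκ'o.le_iff hm2o).2 (hle.trans hr.le)) hm2κ
  refine ⟨M, hMu, hM, j, hj, (j.isOrd hM hj.1).1 _ h1 hmm2,
    fun x _ hx => h2 x trivial (lt_trans hx hr), ?_⟩
  intro y _ hy
  have hy' : y.rank < m.rank := hy
  have hmκ := ZFSet.rank_lt_of_mem hm
  have hyM : y ∈ M := h2 y trivial (hy'.trans hr)
  have h4 : ∀ y ∈ j.toFun (VV κ), (y ∈ j.toFun B ↔ (j.toFun e).pair y ∈ j.toFun A') :=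
    (j.tr hM (n := 4) (P := fun _ v => ∀ y ∈ v 0, (y ∈ v 1 ↔ (v 2).pair y ∈ v 3))
      (Df.ball 0 (P := fun _ v y => (y ∈ v 1 ↔ (v 2).pair y ∈ v 3))
        ((Df.mem _ _).iff (Df.pairMem _ _ _))) ![VV κ, B, e, A']).1 hB
  have h5 := h4 y ((j.mem_V hM hyM).2 ((hy'.trans hmκ).trans_le (j.le_rank hM κ)))
  rw [j.fix' hM hj he] at h5
  rw [hB y (mem_VV.2 (hy'.trans hmκ)), h5]
  refine h3 _ trivial ?_
  unfold VMem
  have h6 := rank_pair_le (he.trans_le hle) hy'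
  refine h6.trans_lt ?_
  rw [hm2, rank_insert_self, hm1, rank_insert_self]
  exact Order.lt_succ _

theorem decode_both {κ κ' A C : ZFSet.{u}} (hκ : IsOrd κ)
    (hlim : ∀ ξ ∈ κ, (insert ξ ξ : ZFSet.{u}) ∈ κ) (hκ' : κ' ∈ κ)
    (hs : LtStrongFor κ' κ (enc κ A C)) : LtStrongFor κ' κ A ∧ LtStrongFor κ' κ C := by
  obtain ⟨M, _, hM, j, hj, _⟩ := hs κ' (Or.inr rfl) hκ'
  have h0 : (∅ : ZFSet.{u}).rank < κ'.rank := ZFSet.rank_lt_of_mem (crit_ne j hM hj)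
  have h1 : ({∅} : ZFSet.{u}).rank < κ'.rank := by
    rw [ZFSet.rank_singleton]
    exact lim_rank (fun ξ hξ => crit_succ j hM hj hξ) h0
  have hlt := ZFSet.rank_lt_of_mem hκ'
  exact ⟨decode hκ hlim hκ' h0 (fun y hy => mem_enc0 hlim (mem_VV.2 (h0.trans hlt)) hy) hs,
    decode hκ hlim hκ' h1 (fun y hy => mem_enc1 hlim (mem_VV.2 (h1.trans hlt)) hy) hs⟩

theorem limC {κ κ' C : ZFSet.{u}} (hκ : IsOrd κ)
    (hlim : ∀ ξ ∈ κ, (insert ξ ξ : ZFSet.{u}) ∈ κ) (hκ' : κ' ∈ κ)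
    (hs : LtStrongFor κ' κ C) (hC : ∀ ξ ∈ κ, ∃ c ∈ κ, c ∈ C ∧ ξ ∈ c) :
    ∀ ξ ∈ κ', ∃ c ∈ κ', c ∈ C ∧ ξ ∈ c := by
  intro ξ hξ
  obtain ⟨c, hc, hcC, hκc⟩ := hC κ' hκ'
  have hco := hκ.mem hc
  have hcm : c ∈ (insert c c : ZFSet.{u}) := ZFSet.mem_insert _ _
  obtain ⟨M, _, hM, j, hj, h1, h2, h3⟩ := hs (insert c c)
    (Or.inl (hco.succ.1 _ hcm hκc)) (hlim c hc)
  have h4 := (h3 c trivial (ZFSet.rank_lt_of_mem hcm)).1 hcC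
  have h5 : (∃ c ∈ κ', c ∈ C ∧ ξ ∈ c) ↔
      ∃ c ∈ j.toFun κ', c ∈ j.toFun C ∧ j.toFun ξ ∈ c :=
    j.tr hM (n := 3) (P := fun _ v => ∃ c ∈ v 0, c ∈ v 1 ∧ v 2 ∈ c)
      (Df.bex 0 (P := fun _ v c => c ∈ v 1 ∧ v 2 ∈ c) ((Df.mem _ _).and (Df.mem _ _))) ![κ', C, ξ]
  refine h5.2 ⟨c, (j.isOrd hM hj.1).1 _ h1 hcm, h4, ?_⟩
  rw [hj.2.2 ξ hξ]
  exact hco.1 _ hκc hξ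


end Part5

section Part6

/-! ### Transferring strongness -/

theorem sim_M {M : Set ZFSet.{u}} (j : ElemEmb (Set.univ : Set ZFSet.{u}) M) (hM : TransClass M)
    {x y : ZFSet.{u}} (hx : x ∈ M) (hy : y ∈ M) (hle : x.rank ≤ y.rank) :
    ∃ r ∈ M, x.pair y ∈ r ∧ SimR r := by
  have h2 : ∀ x ∈ M, ∀ y ∈ M, ∃ r ∈ M, (x.pair y ∈ r ∧ SimR r) ∨
      ∃ x' ∈ x, (y.pair x' ∈ r ∧ SimR r) := by
    refine (j.tr hM (n := 0) (P := fun C v => ∀ x ∈ C, ∀ y ∈ C, ∃ r ∈ C, (x.pair y ∈ r ∧ SimR r) ∨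
      ∃ x' ∈ x, (y.pair x' ∈ r ∧ SimR r)) ?_ ![]).1 ?_
    · exact Df.all (P := fun C v x => ∀ y ∈ C, ∃ r ∈ C, (x.pair y ∈ r ∧ SimR r) ∨
          ∃ x' ∈ x, (y.pair x' ∈ r ∧ SimR r))
        (Df.all (P := fun C w y => ∃ r ∈ C, ((w (Fin.last _)).pair y ∈ r ∧ SimR r) ∨
          ∃ x' ∈ w (Fin.last _), (y.pair x' ∈ r ∧ SimR r))
        (Df.ex (P := fun C w r => ((w (Fin.last _).castSucc).pair (w (Fin.last _)) ∈ r ∧ SimR r) ∨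
          ∃ x' ∈ w (Fin.last _).castSucc, ((w (Fin.last _)).pair x' ∈ r ∧ SimR r))
        (((Df.pairMem _ _ _).and (Df.simR _)).or (Df.bex _
          (P := fun C w x' => ((w (Fin.last _).castSucc).pair x' ∈ w (Fin.last _) ∧
            SimR (w (Fin.last _))))
          ((Df.pairMem _ _ _).and (Df.simR _))))))
    · intro x _ y _
      rcases le_or_gt x.rank y.rank with h | h
      · obtain ⟨r, hr⟩ := exists_sim h
        exact ⟨r, trivial, Or.inl hr⟩
      · obtain ⟨x', hx', h⟩ := ZFSet.lt_rank_iff.1 h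
        obtain ⟨r, hr⟩ := exists_sim h
        exact ⟨r, trivial, Or.inr ⟨x', hx', hr⟩⟩
  obtain ⟨r, hr, h' | ⟨x', hx', h'⟩⟩ := h2 x hx y hy
  · exact ⟨r, hr, h'⟩
  · have := rank_le_of_sim h'.2 _ _ h'.1
    exact absurd ((this.trans_lt (ZFSet.rank_lt_of_mem hx')).trans_le hle) (lt_irrefl _)

/-- The identity embedding. -/
def idEmb : ElemEmb (Set.univ : Set ZFSet.{u}) (Set.univ : Set ZFSet.{u}) :=
  ⟨fun x => x, fun _ _ => trivial, fun _ _ _ => Iff.rfl⟩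

theorem transfer {κ κ' δ A : ZFSet.{u}} (hδ : IsOrd δ) (hκ : κ ∈ δ) (hκ' : κ' ∈ κ)
    (h' : LtStrongFor κ' κ A) (h : LtStrongFor κ δ A) : LtStrongFor κ' δ A := by
  intro l hκl hl
  have hκo := hδ.mem hκ
  have hκ'o := hκo.mem hκ'
  have hlo := hδ.mem hl
  rcases hlo.tri hκo with hlκ | hlκ
  · exact h' l hκl hlκ
  obtain ⟨M, hMu, hM, j, hj, h1, h2, h3⟩ := h l hlκ hl
  have hfam : ∀ a : ZFSet.{u}, ∃ N : Set ZFSet.{u}, TransClass N ∧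
      ∃ k : ElemEmb (Set.univ : Set ZFSet.{u}) N, a ∈ κ → oLe κ' a →
        IsCrit k κ' ∧ a ∈ k.toFun κ' ∧ VIncl N a ∧ AgreeBelow a A (k.toFun A) := by
    intro a
    by_cases hc : a ∈ κ ∧ oLe κ' a
    · obtain ⟨N, _, hN, k, hk⟩ := h' a hc.2 hc.1
      exact ⟨N, hN, k, fun _ _ => hk⟩
    · exact ⟨Set.univ, transClass_univ, idEmb, fun h1 h2 => (hc ⟨h1, h2⟩).elim⟩
  choose N hN k hk using hfam
  obtain ⟨N', hN', J, hJ, -⟩ := image_emb j hM h1 N hN k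
  have econst := ev_const j hM h1
  have eid := ev_id j hM h1
  have hjκ' : j.toFun κ' = κ' := hj.2.2 _ hκ'
  have eκ' : ev j κ l (fun _ => κ') = κ' := (econst κ').trans hjκ'
  have hlJ : l ∈ J.toFun κ' := by
    have hlos := los j hM h1 (n := 3) (P := fun _ v => (v 0 ∈ v 1 ∨ v 0 = v 1) → v 1 ∈ v 2)
      (((Df.mem 0 1).or (Df.eq 0 1)).imp (Df.mem 1 2))
      ![fun _ => κ', fun a => a, fun a => (k a).toFun κ']
      (fun a ha hle => (hk a ha hle).2.1)
    change (ev j κ l (fun _ => κ') ∈ ev j κ l (fun a => a) ∨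
      ev j κ l (fun _ => κ') = ev j κ l (fun a => a)) →
      ev j κ l (fun a => a) ∈ ev j κ l (fun a => (k a).toFun κ') at hlos
    rw [eκ', eid, ← hJ] at hlos
    exact hlos hκl
  have hcrit : IsCrit J κ' := by
    refine ⟨hκ'o, ?_, ?_⟩
    · intro he
      rw [he] at hlJ
      have h4 := ZFSet.rank_lt_of_mem hlJ
      exact absurd ((hκ'o.le_iff hlo).1 hκl) (not_le.2 h4)
    · intro ξ hξ
      have hlos := los j hM h1 (n := 4) (P := fun _ v => (v 0 ∈ v 1 ∨ v 0 = v 1) → v 2 = v 3)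
        (((Df.mem 0 1).or (Df.eq 0 1)).imp (Df.eq 2 3))
        ![fun _ => κ', fun a => a, fun a => (k a).toFun ξ, fun _ => ξ]
        (fun a ha hle => (hk a ha hle).1.2.2 ξ hξ)
      change (ev j κ l (fun _ => κ') ∈ ev j κ l (fun a => a) ∨
        ev j κ l (fun _ => κ') = ev j κ l (fun a => a)) →
        ev j κ l (fun a => (k a).toFun ξ) = ev j κ l (fun _ => ξ) at hlos
      rw [eκ', eid, ← hJ, econst] at hlos
      rw [hlos hκl]
      exact hj.2.2 ξ (hκo.1 _ hκ' hξ)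
  have hlM : l ∈ M := j.mem_of_mem hM h1
  -- the image of `V_a` contains `V_l`
  have hV : ∀ x, x.rank < l.rank → x ∈ ev j κ l VV := by
    intro x hx
    obtain ⟨z, hz, hxz⟩ := ZFSet.lt_rank_iff.1 hx
    have hxM : x ∈ M := h2 x trivial hx
    obtain ⟨r, hr, hr1, hr2⟩ := sim_M j hM hxM (hM _ hlM _ hz) hxz
    have hlos := los j hM h1 (n := 2)
      (P := fun C v => ∀ y ∈ C, ∀ z ∈ v 0, ∀ r ∈ C, y.pair z ∈ r ∧ SimR r → y ∈ v 1)
      (Df.all (P := fun C v y => ∀ z ∈ v 0, ∀ r ∈ C, y.pair z ∈ r ∧ SimR r → y ∈ v 1)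
        (Df.ball _ (P := fun C w z => ∀ r ∈ C, (w (Fin.last _)).pair z ∈ r ∧ SimR r →
            w (Fin.last _) ∈ w (1 : Fin 2).castSucc)
          (Df.all (P := fun C w r => (w (Fin.last _).castSucc).pair (w (Fin.last _)) ∈ r ∧ SimR r →
            w (Fin.last _).castSucc ∈ w (1 : Fin 2).castSucc.castSucc)
            (((Df.pairMem _ _ _).and (Df.simR _)).imp (Df.mem _ _)))))
      ![fun a => a, VV] (fun a ha y _ z hz r _ hr => mem_VV.2
        ((rank_le_of_sim hr.2 _ _ hr.1).trans_lt (ZFSet.rank_lt_of_mem hz)))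
    change ∀ y ∈ M, ∀ z ∈ ev j κ l (fun a => a), ∀ r ∈ M, y.pair z ∈ r ∧ SimR r →
      y ∈ ev j κ l VV at hlos
    rw [eid] at hlos
    exact hlos x hxM z hz r hr ⟨hr1, hr2⟩
  refine ⟨N', Set.subset_univ _, hN', J, hcrit, hlJ, ?_, ?_⟩
  · intro x _ hx
    have hlos := los j hM h1 (n := 4) (P := fun _ v => (v 0 ∈ v 1 ∨ v 0 = v 1) → v 2 ⊆ v 3)
      (((Df.mem 0 1).or (Df.eq 0 1)).imp (Df.sub 2 3))
      ![fun _ => κ', fun a => a, VV, fun a => (k a).toFun (VV κ)]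
      (fun a ha hle => by
        change VV a ⊆ (k a).toFun (VV κ)
        intro y hy
        have hy' := mem_VV.1 hy
        refine ((k a).mem_V (hN a) ((hk a ha hle).2.2.1 y trivial hy')).2 ?_
        exact (hy'.trans (ZFSet.rank_lt_of_mem ha)).trans_le ((k a).le_rank (hN a) κ))
    change (ev j κ l (fun _ => κ') ∈ ev j κ l (fun a => a) ∨
      ev j κ l (fun _ => κ') = ev j κ l (fun a => a)) →
      ev j κ l VV ⊆ ev j κ l (fun a => (k a).toFun (VV κ)) at hlos
    rw [eκ', eid, ← hJ] at hlos
    exact J.mem_of_mem hN' (hlos hκl (hV x hx))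
  · intro x _ hx
    have hlos := los j hM h1 (n := 5)
      (P := fun _ v => (v 0 ∈ v 1 ∨ v 0 = v 1) → ∀ x ∈ v 2, (x ∈ v 3 ↔ x ∈ v 4))
      (((Df.mem 0 1).or (Df.eq 0 1)).imp (Df.ball 2 (P := fun _ v x => (x ∈ v 3 ↔ x ∈ v 4))
        ((Df.mem _ _).iff (Df.mem _ _))))
      ![fun _ => κ', fun a => a, VV, fun _ => A, fun a => (k a).toFun A]
      (fun a ha hle x hx => (hk a ha hle).2.2.2 x trivial (mem_VV.1 hx))
    change (ev j κ l (fun _ => κ') ∈ ev j κ l (fun a => a) ∨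
      ev j κ l (fun _ => κ') = ev j κ l (fun a => a)) → ∀ x ∈ ev j κ l VV,
      (x ∈ ev j κ l (fun _ => A) ↔ x ∈ ev j κ l (fun a => (k a).toFun A)) at hlos
    rw [eκ', eid, ← hJ, econst] at hlos
    exact (h3 x trivial hx).trans (hlos hκl x (hV x hx))

/-! ### Limits of strongly compact cardinals -/

theorem menas {κ δ : ZFSet.{u}} (hδ : IsOrd δ) (hκ : κ ∈ δ) {M : Set ZFSet.{u}}
    (j : ElemEmb (Set.univ : Set ZFSet.{u}) M) (hM : TransClass M) (hj : IsCrit j κ)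
    (hC : ∀ ξ ∈ κ, ∃ c ∈ κ, ξ ∈ c ∧ LtSC c δ) : LtSC κ δ := by
  classical
  intro l hκl hl
  have hκo := hδ.mem hκ
  have hlo := hδ.mem hl
  have hκl' := (hκo.le_iff hlo).1 hκl
  set C : ZFSet.{u} := ZFSet.sep (fun c => LtSC c δ) κ with hCdef
  obtain ⟨b, hb, hκb⟩ : ∃ b ∈ j.toFun C, κ ∈ b := by
    have h1 : ∀ ξ ∈ κ, ∃ c ∈ C, ξ ∈ c := by
      intro ξ hξ
      obtain ⟨c, hc, h1, h2⟩ := hC ξ hξ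
      exact ⟨c, ZFSet.mem_sep.2 ⟨hc, h2⟩, h1⟩
    have h2 : ∀ ξ ∈ j.toFun κ, ∃ c ∈ j.toFun C, ξ ∈ c :=
      (j.tr hM (n := 2) (P := fun _ v => ∀ ξ ∈ v 0, ∃ c ∈ v 1, ξ ∈ c)
        (Df.ball 0 (P := fun _ v ξ => ∃ c ∈ v 1, ξ ∈ c)
          (Df.bex _ (P := fun _ w c => w (Fin.last _) ∈ c) (Df.mem _ _))) ![κ, C]).1 h1
    exact h2 κ (crit_mem j hM hj)
  have hbo : IsOrd b := by
    have hsub : j.toFun C ⊆ j.toFun κ := j.sub hM _ _ (fun c hc => (ZFSet.mem_sep.1 hc).1)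
    exact ord_of_mem_j j hM hκo (hsub hb)
  have hfam : ∀ a : ZFSet.{u}, ∃ N : Set ZFSet.{u}, TransClass N ∧
      ∃ k : ElemEmb (Set.univ : Set ZFSet.{u}) N, ∃ s β f : ZFSet.{u}, a ∈ C →
        IsCrit k a ∧ l ∈ k.toFun a ∧ s ∈ N ∧ (∀ α ∈ l, k.toFun α ∈ s) ∧ β ∈ k.toFun a ∧ f ∈ N ∧
          IsFuncOn s f ∧ MapsInto f β ∧ InjFun f := by
    intro a
    by_cases hc : a ∈ C
    · have hc' := ZFSet.mem_sep.1 hc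
      have hao := hκo.mem hc'.1
      have hal : oLe a l := (hao.le_iff hlo).2 ((ZFSet.rank_lt_of_mem hc'.1).le.trans hκl')
      obtain ⟨N, _, hN, k, hk1, hk2, s, hs, hs2, β, f, hβ, hf, hf1, hf2, hf3⟩ := hc'.2 l hal hl
      exact ⟨N, hN, k, s, β, f, fun _ => ⟨hk1, hk2, hs, hs2, hβ, hf, hf1, hf2, hf3⟩⟩
    · exact ⟨Set.univ, transClass_univ, idEmb, ∅, ∅, ∅, fun h1 => (hc h1).elim⟩
  choose N hN k s β f hk using hfam
  obtain ⟨N', hN', J, hJ, hbd⟩ := image_emb j hM hb N hN k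
  have econst := ev_const j hM hb
  have eid := ev_id j hM hb
  have hkκ : ∀ a ∈ C, ∀ x ∈ (k a).toFun a, x ∈ (k a).toFun κ := by
    intro a ha x hx
    exact ((k a).isOrd (hN a) hκo).1 _
      (((k a).mem_iff (hN a) _ _).2 (ZFSet.mem_sep.1 ha).1) hx
  have hlJ : l ∈ J.toFun κ := by
    have hlos := los j hM hb (Df.mem 0 1) ![fun _ => l, fun a => (k a).toFun κ]
      (fun a ha => hkκ a ha _ (hk a ha).2.1)
    change ev j C b (fun _ => l) ∈ ev j C b (fun a => (k a).toFun κ) at hlos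
    rw [econst, ← hJ] at hlos
    rw [hlo.lt_iff (J.isOrd hN' hκo)]
    exact (j.le_rank hM l).trans_lt (ZFSet.rank_lt_of_mem hlos)
  have hcrit : IsCrit J κ := by
    refine ⟨hκo, ?_, ?_⟩
    · intro he
      rw [he] at hlJ
      exact absurd hκl' (not_le.2 (ZFSet.rank_lt_of_mem hlJ))
    · intro ξ hξ
      have hlos := los j hM hb (n := 3) (P := fun _ v => v 0 ∈ v 1 → v 2 = v 0)
        ((Df.mem 0 1).imp (Df.eq 2 0))
        ![fun _ => ξ, fun a => a, fun a => (k a).toFun ξ]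
        (fun a ha hle => (hk a ha).1.2.2 ξ hle)
      change ev j C b (fun _ => ξ) ∈ ev j C b (fun a => a) →
        ev j C b (fun a => (k a).toFun ξ) = ev j C b (fun _ => ξ) at hlos
      rw [econst, eid, ← hJ, hj.2.2 ξ hξ] at hlos
      exact hlos (hbo.1 _ hκb hξ)
  refine ⟨N', Set.subset_univ _, hN', J, hcrit, hlJ, ev j C b s, hbd s (fun a ha => (hk a ha).2.2.1),
    ?_, ev j C b β, ev j C b f, ?_, hbd f (fun a ha => (hk a ha).2.2.2.2.2.1), ?_, ?_, ?_⟩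
  · intro α hα
    rw [hJ]
    exact los j hM hb (Df.mem 0 1) ![fun a => (k a).toFun α, s]
      (fun a ha => (hk a ha).2.2.2.1 α hα)
  · rw [hJ]
    exact los j hM hb (Df.mem 0 1) ![β, fun a => (k a).toFun κ]
      (fun a ha => hkκ a ha _ (hk a ha).2.2.2.2.1)
  · exact los j hM hb (Df.isFuncOn 0 1) ![s, f] (fun a ha => (hk a ha).2.2.2.2.2.2.1)
  · exact los j hM hb (Df.mapsInto 0 1) ![f, β] (fun a ha => (hk a ha).2.2.2.2.2.2.2.1)
  · exact los j hM hb (Df.injFun 0) ![f] (fun a ha => (hk a ha).2.2.2.2.2.2.2.2)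

/-! ### The main argument -/

theorem main_aux {δ A : ZFSet.{u}} (h : Vopenka δ) :
    ∃ κ : ZFSet.{u}, κ ∈ δ ∧ IsCard κ ∧ LtSC κ δ ∧ LtStrongFor κ δ A ∧ ¬ Woodin κ := by
  have hδ := h.1.1
  let P : ZFSet.{u} → Prop := fun κ => κ ∈ δ ∧ LtStrongFor κ δ A ∧
    ∀ ξ ∈ κ, ∃ c ∈ κ, ξ ∈ c ∧ LtSC c δ
  have hex : ∃ κ, P κ := by
    set C : ZFSet.{u} := ZFSet.sep (fun c => LtSC c δ) δ with hCdef
    obtain ⟨κ, hκ, hs⟩ := h.2 (enc δ A C) trivial (enc_sub _ _ _)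
    obtain ⟨h1, h2⟩ := decode_both hδ (vop_succ h) hκ (sup_strong h hs)
    have h3 := limC hδ (vop_succ h) hκ h2 (fun ξ hξ => by
      obtain ⟨c, hc, hξc, B, hB⟩ := vop_unb h hξ
      exact ⟨c, hc, ZFSet.mem_sep.2 ⟨hc, sup_SC hB⟩, hξc⟩)
    refine ⟨κ, hκ, h1, fun ξ hξ => ?_⟩
    obtain ⟨c, hc, hcC, hξc⟩ := h3 ξ hξ
    exact ⟨c, hc, hξc, (ZFSet.mem_sep.1 hcC).2⟩
  obtain ⟨κ, ⟨hκ, hst, hlim⟩, hmin⟩ := ZFSet.mem_wf.has_min {κ | P κ} hex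
  have hκo := hδ.mem hκ
  obtain ⟨M, _, hM, j, hj, _⟩ := hst κ (Or.inr rfl) hκ
  refine ⟨κ, hκ, crit_card j hM hj, menas hδ hκ j hM hj hlim, hst, fun hW => ?_⟩
  have hsucc : ∀ ξ ∈ κ, (insert ξ ξ : ZFSet.{u}) ∈ κ := fun ξ hξ => crit_succ j hM hj hξ
  set C : ZFSet.{u} := ZFSet.sep (fun c => LtSC c δ) κ with hCdef
  obtain ⟨κ', hκ', hs⟩ := hW.2 (enc κ A C) trivial (enc_sub _ _ _)
  obtain ⟨h1, h2⟩ := decode_both hκo hsucc hκ' hs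
  have h3 := limC hκo hsucc hκ' h2 (fun ξ hξ => by
    obtain ⟨c, hc, hξc, hB⟩ := hlim ξ hξ
    exact ⟨c, hc, ZFSet.mem_sep.2 ⟨hc, hB⟩, hξc⟩)
  refine hmin κ' ⟨hδ.1 _ hκ hκ', transfer hδ hκ hκ' h1 hst, fun ξ hξ => ?_⟩ hκ'
  obtain ⟨c, hc, hcC, hξc⟩ := h3 ξ hξ
  exact ⟨c, hc, hξc, (ZFSet.mem_sep.1 hcC).2⟩


end Part6

end Proof

/-- **Claim.**  If `δ` is Vopěnka, then for every `A ⊆ V_δ` there is a cardinal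
`κ < δ` which is `<δ`-strongly compact and `<δ`-strong for `A` but not Woodin. -/
theorem vopenka_gives_non_woodin_witnesses (δ : ZFSet) (h : Vopenka δ) :
    ∀ A : ZFSet, SubV A δ → ∃ κ : ZFSet, κ ∈ δ ∧ IsCard κ ∧
      LtSC κ δ ∧ LtStrongFor κ δ A ∧ ¬ Woodin κ := by
  intro A _
  exact main_aux h

end WSC
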